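/- arXiv:math/0501063 — 2 statements merged into one kernel-verified Lean document; each statement's English description precedes it below -/
import Mathlib

section
/- Let (R, m) be a commutative Noetherian local ring, a an ideal of R, and M a finitely generated R-module of dimension n. Then the set of attached primes of the top local cohomology module H_a^n(M) equals { p ∈ Supp(M) : H_a^n(R/p) ≠ 0 }. -/
noncomputable section

universe u

open CategoryTheory

/-- The `i`-th local cohomology of a module with respect to an ideal. -/
abbrev LC {R : Type u} [CommRing R] (J : Ideal R) (i : ℕ) (M : Type u)
    [AddCommGroup M] [Module R M] : ModuleCat.{u} R :=
  (localCohomology J i).obj (ModuleCat.of R M)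

/-- Attached primes of a module: primes of the form `Ann(T/U)`. -/
def Att (R : Type u) [CommRing R] (T : Type u) [AddCommGroup T] [Module R T] :
    Set (Ideal R) :=
  { p | p.IsPrime ∧ ∃ U : Submodule R T, p = Module.annihilator R (T ⧸ U) }

/-- Krull dimension of a module, as the Krull dimension of its support. -/
def mdim (R : Type u) [CommRing R] (M : Type u) [AddCommGroup M] [Module R M] :
    WithBot ℕ∞ :=
  Order.krullDim (Module.support R M)

section ExtRel
open Opposite HomologicalComplex
variable {R : Type u} [CommRing R]

/-- The complex `Hom(P, Y)` in the opposite category. -/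
def homCpx (P : ChainComplex (ModuleCat.{u} R) ℕ) (Y : ModuleCat.{u} R) :
    ChainComplex (ModuleCat.{u} R)ᵒᵖ ℕ :=
  (((linearYoneda R (ModuleCat.{u} R)).obj Y).rightOp.mapHomologicalComplex _).obj P

/-- `f` is a cocycle representing the class `e`. -/
def ExtRel {X : ModuleCat.{u} R} (P : ProjectiveResolution X) (Y : ModuleCat.{u} R) (n : ℕ)
    (f : P.complex.X n ⟶ Y) (e : ((Ext R (ModuleCat.{u} R) n).obj (op X)).obj Y) : Prop :=
  ∃ z : ((homCpx P.complex Y).opcycles n).unop,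
    ((homCpx P.complex Y).pOpcycles n).unop.hom z = f ∧
    (P.isoLeftDerivedObj ((linearYoneda R (ModuleCat.{u} R)).obj Y).rightOp n).hom.unop.hom
      (((homCpx P.complex Y).homologyι n).unop.hom z) = e

variable {X : ModuleCat.{u} R} {P : ProjectiveResolution X} {Y : ModuleCat.{u} R} {n : ℕ}

lemma ExtRel.add {f g : P.complex.X n ⟶ Y} {e e'} (h : ExtRel P Y n f e) (h' : ExtRel P Y n g e') :
    ExtRel P Y n (f + g) (e + e') := by
  obtain ⟨z, rfl, rfl⟩ := h
  obtain ⟨z', rfl, rfl⟩ := h'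
  refine ⟨z + z', ?_, ?_⟩
  · erw [map_add]; rfl
  · erw [map_add, map_add]; rfl

lemma ExtRel.smul {f : P.complex.X n ⟶ Y} {e} (r : R) (h : ExtRel P Y n f e) :
    ExtRel P Y n (r • f) (r • e) := by
  obtain ⟨z, rfl, rfl⟩ := h
  refine ⟨r • z, ?_, ?_⟩
  · erw [map_smul]; rfl
  · erw [map_smul, map_smul]; rfl

lemma ExtRel.exists_of_cocycle (f : P.complex.X n ⟶ Y) (hf : P.complex.d (n+1) n ≫ f = 0) :
    ∃ e, ExtRel P Y n f e := by
  have h := ((homCpx P.complex Y).opcyclesIsCokernel (n+1) n (by simp))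
  have h2 : (ShortComplex.mk _ _ ((homCpx P.complex Y).d_pOpcycles (n+1) n)).Exact :=
    ShortComplex.exact_of_g_is_cokernel _ h
  have h3 := (ShortComplex.moduleCat_exact_iff _).1 h2.unop f hf
  obtain ⟨z, hz⟩ := h3
  exact ⟨_, z, hz, rfl⟩

lemma ExtRel.exists_rep (e : ((Ext R (ModuleCat.{u} R) n).obj (op X)).obj Y) :
    ∃ f : P.complex.X n ⟶ Y, P.complex.d (n+1) n ≫ f = 0 ∧ ExtRel P Y n f e := by
  have h1 : Function.Surjective ((homCpx P.complex Y).homologyι n).unop.hom :=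
    (ModuleCat.epi_iff_surjective _).1 inferInstance
  have h2 : Function.Surjective
      (P.isoLeftDerivedObj ((linearYoneda R (ModuleCat.{u} R)).obj Y).rightOp n).hom.unop.hom :=
    (ModuleCat.epi_iff_surjective _).1 inferInstance
  obtain ⟨w, hw⟩ := h2 e
  obtain ⟨z, rfl⟩ := h1 w
  refine ⟨((homCpx P.complex Y).pOpcycles n).unop.hom z, ?_, z, rfl, hw⟩
  have := congrArg (fun q => q.unop.hom z) ((homCpx P.complex Y).d_pOpcycles (n+1) n)
  exact this

lemma ExtRel.eq_zero_of_coboundary {j : ℕ} {g : P.complex.X j ⟶ Y} {e}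
    (h : ExtRel P Y n (P.complex.d n j ≫ g) e) : e = 0 := by
  obtain ⟨z, hz, rfl⟩ := h
  have h1 : Function.Injective ((homCpx P.complex Y).pOpcycles n).unop.hom :=
    (ModuleCat.mono_iff_injective _).1 inferInstance
  have h2 := congrArg (fun q => q.unop.hom g) ((homCpx P.complex Y).p_fromOpcycles n j)
  have h3 := congrArg (fun q => q.unop.hom g) ((homCpx P.complex Y).homologyι_comp_fromOpcycles n j)
  have h4 : z = ((homCpx P.complex Y).fromOpcycles n j).unop.hom g := h1 (hz.trans h2.symm)
  rw [h4]
  erw [h3]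
  exact map_zero _

lemma ExtRel.coboundary_of_zero {f : P.complex.X n ⟶ Y} (h : ExtRel P Y n f 0) :
    ∃ g : P.complex.X ((ComplexShape.down ℕ).next n) ⟶ Y, P.complex.d n _ ≫ g = f := by
  obtain ⟨z, hz, h⟩ := h
  have h2 : Function.Injective
      (P.isoLeftDerivedObj ((linearYoneda R (ModuleCat.{u} R)).obj Y).rightOp n).hom.unop.hom :=
    (ModuleCat.mono_iff_injective _).1 inferInstance
  have h3 : ((homCpx P.complex Y).homologyι n).unop.hom z = 0 := h2 (h.trans (map_zero _).symm)
  have h4 : (ShortComplex.mk _ _ ((homCpx P.complex Y).homologyι_comp_fromOpcycles n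
     ((ComplexShape.down ℕ).next n))).Exact :=
    ShortComplex.exact_of_f_is_kernel _ ((homCpx P.complex Y).homologyIsKernel n _ rfl)
  obtain ⟨g, hg⟩ := (ShortComplex.moduleCat_exact_iff _).1 h4.unop z h3
  refine ⟨g, ?_⟩
  have h2 := congrArg (fun q => q.unop.hom g) ((homCpx P.complex Y).p_fromOpcycles n ((ComplexShape.down ℕ).next n))
  rw [← hz, ← hg]
  exact h2.symm

lemma ExtRel.map_left {X' : ModuleCat.{u} R} {Q : ProjectiveResolution X'} (α : X' ⟶ X)
    (φ : Q.complex ⟶ P.complex) (comm : φ.f 0 ≫ P.π.f 0 = Q.π.f 0 ≫ α)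
    {f : P.complex.X n ⟶ Y} {e} (h : ExtRel P Y n f e) :
    ExtRel Q Y n (φ.f n ≫ f) ((((Ext R (ModuleCat.{u} R) n).map α.op).app Y).hom e) := by
  obtain ⟨z, rfl, rfl⟩ := h
  let F := ((linearYoneda R (ModuleCat.{u} R)).obj Y).rightOp
  let ψ : homCpx Q.complex Y ⟶ homCpx P.complex Y := (F.mapHomologicalComplex _).map φ
  refine ⟨(opcyclesMap ψ n).unop.hom z, ?_, ?_⟩
  · exact congrArg (fun q => q.unop.hom z) (p_opcyclesMap ψ n)
  · have h1 := congrArg (fun q => q.unop.hom z) (homologyι_naturality ψ n)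
    have h2 := congrArg (fun q => q.unop.hom (((homCpx P.complex Y).homologyι n).unop.hom z))
      (ProjectiveResolution.isoLeftDerivedObj_hom_naturality α Q P φ comm F n)
    refine Eq.trans ?_ h2.symm
    exact congrArg ((Q.isoLeftDerivedObj F n).hom.unop.hom) h1.symm

lemma ExtRel.map_right {Y' : ModuleCat.{u} R} (β : Y ⟶ Y')
    {f : P.complex.X n ⟶ Y} {e} (h : ExtRel P Y n f e) :
    ExtRel P Y' n (f ≫ β) ((((Ext R (ModuleCat.{u} R) n).obj (op X)).map β).hom e) := by
  obtain ⟨z, rfl, rfl⟩ := h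
  let α := NatTrans.rightOp ((linearYoneda R (ModuleCat.{u} R)).map β)
  let ψ : homCpx P.complex Y' ⟶ homCpx P.complex Y :=
    (NatTrans.mapHomologicalComplex α _).app P.complex
  refine ⟨(opcyclesMap ψ n).unop.hom z, ?_, ?_⟩
  · exact congrArg (fun q => q.unop.hom z) (p_opcyclesMap ψ n)
  · have h1 := congrArg (fun q => q.unop.hom z) (homologyι_naturality ψ n)
    have h2' := ProjectiveResolution.leftDerived_app_eq α P n
    rw [← Category.assoc, Iso.eq_comp_inv] at h2'
    have h2 := congrArg (fun q => q.unop.hom (((homCpx P.complex Y).homologyι n).unop.hom z)) h2'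
    refine Eq.trans ?_ h2.symm
    exact congrArg ((P.isoLeftDerivedObj
      ((linearYoneda R (ModuleCat.{u} R)).obj Y').rightOp n).hom.unop.hom) h1.symm
end ExtRel

section LCRel
open Opposite HomologicalComplex Limits
variable {R : Type u} [CommRing R] (a : Ideal R)

/-- the chosen resolution of `R/a^t` -/
abbrev resP (t : ℕ) : ProjectiveResolution (ModuleCat.of R (R ⧸ a ^ t)) :=
  projectiveResolution _

/-- transition map -/
def trMap {t t' : ℕ} (h : t ≤ t') :
    ModuleCat.of R (R ⧸ a ^ t') ⟶ ModuleCat.of R (R ⧸ a ^ t) :=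
  (localCohomology.ringModIdeals (localCohomology.idealPowersDiagram a)).map (homOfLE h).op

/-- structure map from Ext to local cohomology -/
def lcι (t i : ℕ) (N : ModuleCat.{u} R) :
    ((Ext R (ModuleCat.{u} R) i).obj (op (ModuleCat.of R (R ⧸ a ^ t)))).obj N ⟶
      (localCohomology a i).obj N :=
  haveI := localCohomology.hasColimitDiagram.{u,0} (localCohomology.idealPowersDiagram a) i
  (colimit.ι (localCohomology.diagram (localCohomology.idealPowersDiagram a) i) (op (op t))).app N

lemma lcι_map {t i : ℕ} {N N' : ModuleCat.{u} R} (β : N ⟶ N') :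
    lcι a t i N ≫ (localCohomology a i).map β =
    ((Ext R (ModuleCat.{u} R) i).obj (op (ModuleCat.of R (R ⧸ a ^ t)))).map β ≫ lcι a t i N' :=
  have := localCohomology.hasColimitDiagram.{u,0} (localCohomology.idealPowersDiagram a) i
  ((colimit.ι (localCohomology.diagram (localCohomology.idealPowersDiagram a) i)
    (op (op t))).naturality β).symm

lemma lcι_tr {t t' i : ℕ} (h : t ≤ t') (N : ModuleCat.{u} R) :
    ((Ext R (ModuleCat.{u} R) i).map (trMap a h).op).app N ≫ lcι a t' i N = lcι a t i N :=
  have := localCohomology.hasColimitDiagram.{u,0} (localCohomology.idealPowersDiagram a) i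
  congrArg (fun q => q.app N)
   (colimit.w (localCohomology.diagram (localCohomology.idealPowersDiagram a) i) (homOfLE h).op.op)

lemma lcι_rep {i : ℕ} {N : ModuleCat.{u} R} (x : (localCohomology a i).obj N) :
    ∃ t e, (lcι a t i N).hom e = x := by
  have := localCohomology.hasColimitDiagram.{u,0} (localCohomology.idealPowersDiagram a) i
  have : IsFiltered ℕᵒᵖᵒᵖ := IsFiltered.of_equivalence (opOpEquivalence ℕ).symm
  have : PreservesFilteredColimitsOfSize.{0, 0} (CategoryTheory.forget (ModuleCat.{u} R)) :=
    preservesFilteredColimitsOfSize_shrink.{0, u, 0, u} _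
  have hc := isColimitOfPreserves ((evaluation _ _).obj N)
    (colimit.isColimit (localCohomology.diagram (localCohomology.idealPowersDiagram a) i))
  obtain ⟨j, e, he⟩ := Concrete.isColimit_exists_rep _ hc x
  exact ⟨j.unop.unop, e, he⟩

lemma lcι_zero {t i : ℕ} {N : ModuleCat.{u} R} (e) (h : (lcι a t i N).hom e = 0) :
    ∃ t', ∃ h : t ≤ t', (((Ext R (ModuleCat.{u} R) i).map (trMap a h).op).app N).hom e = 0 := by
  have := localCohomology.hasColimitDiagram.{u,0} (localCohomology.idealPowersDiagram a) i
  have : IsFiltered ℕᵒᵖᵒᵖ := IsFiltered.of_equivalence (opOpEquivalence ℕ).symm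
  have : PreservesFilteredColimitsOfSize.{0, 0} (CategoryTheory.forget (ModuleCat.{u} R)) :=
    preservesFilteredColimitsOfSize_shrink.{0, u, 0, u} _
  have hc := isColimitOfPreserves ((evaluation _ _).obj N)
    (colimit.isColimit (localCohomology.diagram (localCohomology.idealPowersDiagram a) i))
  have := (Concrete.isColimit_rep_eq_iff_exists _ hc (i := op (op t)) (j := op (op t)) e 0).1
    (h.trans (map_zero _).symm)
  obtain ⟨k, f, g, hfg⟩ := this
  refine ⟨k.unop.unop, leOfHom f.unop.unop, ?_⟩
  refine Eq.trans hfg (map_zero _)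

/-- `f` is a cocycle representing `x` in local cohomology -/
def LCRel (t i : ℕ) (N : ModuleCat.{u} R) (f : (resP a t).complex.X i ⟶ N)
    (x : (localCohomology a i).obj N) : Prop :=
  ∃ e, ExtRel (resP a t) N i f e ∧ (lcι a t i N).hom e = x

variable {a} {t i : ℕ} {N : ModuleCat.{u} R}

lemma LCRel.add {f g : (resP a t).complex.X i ⟶ N} {x y} (h : LCRel a t i N f x)
    (h' : LCRel a t i N g y) : LCRel a t i N (f + g) (x + y) := by
  obtain ⟨e, he, rfl⟩ := h
  obtain ⟨e', he', rfl⟩ := h'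
  exact ⟨e + e', he.add he', map_add _ _ _⟩

lemma LCRel.smul {f : (resP a t).complex.X i ⟶ N} {x} (r : R) (h : LCRel a t i N f x) :
    LCRel a t i N (r • f) (r • x) := by
  obtain ⟨e, he, rfl⟩ := h
  exact ⟨r • e, he.smul r, map_smul _ _ _⟩

lemma LCRel.exists_of_cocycle (f : (resP a t).complex.X i ⟶ N)
    (hf : (resP a t).complex.d (i+1) i ≫ f = 0) : ∃ x, LCRel a t i N f x := by
  obtain ⟨e, he⟩ := ExtRel.exists_of_cocycle f hf
  exact ⟨_, e, he, rfl⟩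

lemma LCRel.exists_rep (x : (localCohomology a i).obj N) :
    ∃ t, ∃ f : (resP a t).complex.X i ⟶ N, (resP a t).complex.d (i+1) i ≫ f = 0 ∧
      LCRel a t i N f x := by
  obtain ⟨t, e, rfl⟩ := lcι_rep a x
  obtain ⟨f, hf, hfe⟩ := ExtRel.exists_rep (P := resP a t) e
  exact ⟨t, f, hf, e, hfe, rfl⟩

lemma LCRel.eq_zero_of_coboundary {j : ℕ} {g : (resP a t).complex.X j ⟶ N} {x}
    (h : LCRel a t i N ((resP a t).complex.d i j ≫ g) x) : x = 0 := by
  obtain ⟨e, he, rfl⟩ := h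
  rw [he.eq_zero_of_coboundary, map_zero]

lemma LCRel.unique {f : (resP a t).complex.X i ⟶ N} {x y} (h : LCRel a t i N f x)
    (h' : LCRel a t i N f y) : x = y := by
  have := h.add (h'.smul (-1))
  have h2 : f + (-1 : R) • f = (resP a t).complex.d i i ≫ 0 := by simp
  rw [h2] at this
  have := this.eq_zero_of_coboundary
  rw [neg_smul, one_smul, add_neg_eq_zero] at this
  exact this

lemma LCRel.map_left {t' : ℕ} (h : t ≤ t') (φ : (resP a t').complex ⟶ (resP a t).complex)
    (comm : φ.f 0 ≫ (resP a t).π.f 0 = (resP a t').π.f 0 ≫ trMap a h)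
    {f : (resP a t).complex.X i ⟶ N} {x} (hx : LCRel a t i N f x) :
    LCRel a t' i N (φ.f i ≫ f) x := by
  obtain ⟨e, he, rfl⟩ := hx
  refine ⟨_, he.map_left (trMap a h) φ comm, ?_⟩
  exact congrArg (fun q => q.hom e) (lcι_tr a h N)

lemma LCRel.map_right {N' : ModuleCat.{u} R} (β : N ⟶ N')
    {f : (resP a t).complex.X i ⟶ N} {x} (hx : LCRel a t i N f x) :
    LCRel a t i N' (f ≫ β) (((localCohomology a i).map β).hom x) := by
  obtain ⟨e, he, rfl⟩ := hx
  refine ⟨_, he.map_right β, ?_⟩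
  exact congrArg (fun q => q.hom e) (lcι_map a β).symm

lemma LCRel.coboundary_of_zero {f : (resP a t).complex.X i ⟶ N} (hx : LCRel a t i N f 0) :
    ∃ t', ∃ h : t ≤ t', ∃ φ : (resP a t').complex ⟶ (resP a t).complex,
      φ.f 0 ≫ (resP a t).π.f 0 = (resP a t').π.f 0 ≫ trMap a h ∧
      ∃ g : (resP a t').complex.X ((ComplexShape.down ℕ).next i) ⟶ N,
        (resP a t').complex.d i _ ≫ g = φ.f i ≫ f := by
  obtain ⟨e, he, h0⟩ := hx
  obtain ⟨t', h, h'⟩ := lcι_zero a e h0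
  let φ := ProjectiveResolution.lift (trMap a h) (resP a t') (resP a t)
  have comm : φ.f 0 ≫ (resP a t).π.f 0 = (resP a t').π.f 0 ≫ trMap a h :=
    ProjectiveResolution.lift_commutes_zero _ _ _
  refine ⟨t', h, φ, comm, ?_⟩
  have h2 := he.map_left (trMap a h) φ comm
  rw [h'] at h2
  exact h2.coboundary_of_zero
end LCRel

section LCExact
open Opposite HomologicalComplex Limits
variable {R : Type u} [CommRing R] {a : Ideal R} {t i : ℕ} {N : ModuleCat.{u} R}

lemma LCRel.sub {f g : (resP a t).complex.X i ⟶ N} {x y} (h : LCRel a t i N f x)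
    (h' : LCRel a t i N g y) : LCRel a t i N (f - g) (x - y) := by
  have := h.add (h'.smul (-1))
  simpa [sub_eq_add_neg] using this

lemma LCRel.coboundary (j : ℕ) (g : (resP a t).complex.X j ⟶ N) :
    LCRel a t i N ((resP a t).complex.d i j ≫ g) 0 := by
  obtain ⟨x, hx⟩ := LCRel.exists_of_cocycle (a := a) ((resP a t).complex.d i j ≫ g) (by simp)
  have := hx.eq_zero_of_coboundary
  rwa [this] at hx

lemma LCRel.coboundary_of_zero_succ {f : (resP a t).complex.X (i+1) ⟶ N}
    (hx : LCRel a t (i+1) N f 0) :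
    ∃ t', ∃ h : t ≤ t', ∃ φ : (resP a t').complex ⟶ (resP a t).complex,
      φ.f 0 ≫ (resP a t).π.f 0 = (resP a t').π.f 0 ≫ trMap a h ∧
      ∃ g : (resP a t').complex.X i ⟶ N,
        (resP a t').complex.d (i+1) i ≫ g = φ.f (i+1) ≫ f := by
  obtain ⟨t', h, φ, comm, g, hg⟩ := hx.coboundary_of_zero
  refine ⟨t', h, φ, comm, ?_⟩
  revert g
  rw [ChainComplex.next_nat_succ]
  exact fun g hg => ⟨g, hg⟩

lemma LC_map_add {N' : ModuleCat.{u} R} (β γ : N ⟶ N') (x : (localCohomology a i).obj N) :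
    ((localCohomology a i).map (β + γ)).hom x =
      ((localCohomology a i).map β).hom x + ((localCohomology a i).map γ).hom x := by
  obtain ⟨t, f, -, hf⟩ := LCRel.exists_rep x
  have h1 := hf.map_right (β + γ)
  rw [Preadditive.comp_add] at h1
  exact h1.unique ((hf.map_right β).add (hf.map_right γ))

lemma LC_map_smul {N' : ModuleCat.{u} R} (r : R) (β : N ⟶ N') (x : (localCohomology a i).obj N) :
    ((localCohomology a i).map (r • β)).hom x = r • ((localCohomology a i).map β).hom x := by
  obtain ⟨t, f, -, hf⟩ := LCRel.exists_rep x
  have h1 := hf.map_right (r • β)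
  rw [Linear.comp_smul] at h1
  exact h1.unique ((hf.map_right β).smul r)

lemma LC_map_zero {N' : ModuleCat.{u} R} (x : (localCohomology a i).obj N) :
    ((localCohomology a i).map (0 : N ⟶ N')).hom x = 0 := by
  have := LC_map_smul (0 : R) (0 : N ⟶ N') x
  simpa using this

lemma LC_map_sum {N' : ModuleCat.{u} R} {ι : Type*} (s : Finset ι) (β : ι → (N ⟶ N'))
    (x : (localCohomology a i).obj N) :
    ((localCohomology a i).map (∑ j ∈ s, β j)).hom x =
      ∑ j ∈ s, ((localCohomology a i).map (β j)).hom x := by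
  classical
  induction s using Finset.induction_on with
  | empty => simp [LC_map_zero]
  | insert j s hj ih => rw [Finset.sum_insert hj, Finset.sum_insert hj, LC_map_add, ih]

lemma LC_map_id (x : (localCohomology a i).obj N) :
    ((localCohomology a i).map (𝟙 N)).hom x = x := by
  rw [CategoryTheory.Functor.map_id]; rfl

lemma LC_map_comp {N' N'' : ModuleCat.{u} R} (β : N ⟶ N') (γ : N' ⟶ N'')
    (x : (localCohomology a i).obj N) :
    ((localCohomology a i).map (β ≫ γ)).hom x =
      ((localCohomology a i).map γ).hom (((localCohomology a i).map β).hom x) := by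
  rw [CategoryTheory.Functor.map_comp]; rfl


lemma LC_surj {S : ShortComplex (ModuleCat.{u} R)} (hS : S.ShortExact)
    [Subsingleton ((localCohomology a (i+1)).obj S.X₁)] :
    Function.Surjective ((localCohomology a i).map S.g).hom := by
  intro x
  have := hS.epi_g
  have := hS.mono_f
  obtain ⟨t, f, hf, hfx⟩ := LCRel.exists_rep x
  let f' : (resP a t).complex.X i ⟶ S.X₂ := Projective.factorThru f S.g
  have hf' : f' ≫ S.g = f := Projective.factorThru_comp _ _
  have h1 : ((resP a t).complex.d (i+1) i ≫ f') ≫ S.g = 0 := by rw [Category.assoc, hf', hf]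
  let k := hS.exact.lift _ h1
  have hk : k ≫ S.f = (resP a t).complex.d (i+1) i ≫ f' := hS.exact.lift_f _ h1
  have hk0 : (resP a t).complex.d (i+1+1) (i+1) ≫ k = 0 := by
    rw [← cancel_mono S.f, Category.assoc, hk]; simp
  obtain ⟨y, hy⟩ := LCRel.exists_of_cocycle k hk0
  rw [Subsingleton.elim y 0] at hy
  obtain ⟨t', h, φ, comm, g, hg⟩ := hy.coboundary_of_zero_succ
  have hz0 : (resP a t').complex.d (i+1) i ≫ (φ.f i ≫ f' - g ≫ S.f) = 0 := by
    rw [Preadditive.comp_sub, ← Category.assoc _ g, hg, Category.assoc, hk,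
      ← φ.comm_assoc, sub_self]
  obtain ⟨z, hz⟩ := LCRel.exists_of_cocycle _ hz0
  refine ⟨z, ?_⟩
  have h3 := hz.map_right S.g
  have h4 : (φ.f i ≫ f' - g ≫ S.f) ≫ S.g = φ.f i ≫ f := by simp [hf']
  rw [h4] at h3
  exact h3.unique (hfx.map_left h φ comm)

lemma LC_exact {S : ShortComplex (ModuleCat.{u} R)} (hS : S.ShortExact)
    (x : (localCohomology a i).obj S.X₂)
    (hx : ((localCohomology a i).map S.g).hom x = 0) :
    ∃ y, ((localCohomology a i).map S.f).hom y = x := by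
  have := hS.epi_g
  have := hS.mono_f
  obtain ⟨t, f, hf, hfx⟩ := LCRel.exists_rep x
  have h1 := hfx.map_right S.g
  rw [hx] at h1
  obtain ⟨t', h, φ, comm, g, hg⟩ := h1.coboundary_of_zero
  let g' := Projective.factorThru g S.g
  have hg' : g' ≫ S.g = g := Projective.factorThru_comp _ _
  let w := φ.f i ≫ f - (resP a t').complex.d i _ ≫ g'
  have hw : w ≫ S.g = 0 := by simp [w, hg', hg]
  have hw0 : (resP a t').complex.d (i+1) i ≫ w = 0 := by
    simp only [w, Preadditive.comp_sub, ← φ.comm_assoc, hf]; simp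
  have hwx : LCRel a t' i _ w (x - 0) := (hfx.map_left h φ comm).sub (LCRel.coboundary _ g')
  let k := hS.exact.lift _ hw
  have hk : k ≫ S.f = w := hS.exact.lift_f _ hw
  have hk0 : (resP a t').complex.d (i+1) i ≫ k = 0 := by
    rw [← cancel_mono S.f, Category.assoc, hk, hw0]; simp
  obtain ⟨y, hy⟩ := LCRel.exists_of_cocycle k hk0
  refine ⟨y, ?_⟩
  have h3 := hy.map_right S.f
  rw [hk] at h3
  rw [sub_zero] at hwx
  exact h3.unique hwx

lemma LC_inj {S : ShortComplex (ModuleCat.{u} R)} (hS : S.ShortExact)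
    [Subsingleton ((localCohomology a i).obj S.X₃)]
    (x : (localCohomology a (i+1)).obj S.X₁)
    (hx : ((localCohomology a (i+1)).map S.f).hom x = 0) : x = 0 := by
  have := hS.epi_g
  have := hS.mono_f
  obtain ⟨t, f, hf, hfx⟩ := LCRel.exists_rep x
  have h1 := hfx.map_right S.f
  rw [hx] at h1
  obtain ⟨t', h, φ, comm, g, hg⟩ := h1.coboundary_of_zero_succ
  have hc : (resP a t').complex.d (i+1) i ≫ (g ≫ S.g) = 0 := by
    rw [← Category.assoc, hg]; simp
  obtain ⟨y, hy⟩ := LCRel.exists_of_cocycle _ hc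
  rw [Subsingleton.elim y 0] at hy
  obtain ⟨t'', h', φ', comm', q, hq⟩ := hy.coboundary_of_zero
  let q' := Projective.factorThru q S.g
  have hq' : q' ≫ S.g = q := Projective.factorThru_comp _ _
  let w := φ'.f i ≫ g - (resP a t'').complex.d i _ ≫ q'
  have hw : w ≫ S.g = 0 := by simp [w, hq', hq]
  let k := hS.exact.lift _ hw
  have hk : k ≫ S.f = w := hS.exact.lift_f _ hw
  have hk1 : (resP a t'').complex.d (i+1) i ≫ k = φ'.f (i+1) ≫ φ.f (i+1) ≫ f := by
    rw [← cancel_mono S.f, Category.assoc, hk]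
    simp only [w, Preadditive.comp_sub, ← φ'.comm_assoc, hg]; simp
  have h3 := (hfx.map_left h φ comm).map_left h' φ' comm'
  rw [← hk1] at h3
  exact h3.eq_zero_of_coboundary
end LCExact

section Tors
open Opposite HomologicalComplex Limits
variable {R : Type u} [CommRing R] {a : Ideal R} {t i : ℕ} {N : ModuleCat.{u} R}

lemma LC_torsion (x : (localCohomology a i).obj N) : ∃ t : ℕ, ∀ r ∈ a ^ t, r • x = 0 := by
  obtain ⟨t, f, hf, hfx⟩ := LCRel.exists_rep x
  refine ⟨t, fun r hr => ?_⟩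
  have h0 : (r • 𝟙 (resP a t).complex) ≫ (resP a t).π = 0 := by
    ext1
    rw [Linear.smul_comp, Category.id_comp, HomologicalComplex.smul_f_apply]
    have : ∀ y : ((ChainComplex.single₀ (ModuleCat.{u} R)).obj (ModuleCat.of R (R ⧸ a ^ t))).X 0,
        r • y = 0 := by
      intro y
      change r • (show R ⧸ a ^ t from y) = 0
      obtain ⟨s, hs⟩ := Ideal.Quotient.mk_surjective (show R ⧸ a ^ t from y)
      rw [← hs, ← Ideal.Quotient.mk_eq_mk, ← Submodule.Quotient.mk_smul,
        Submodule.Quotient.mk_eq_zero]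
      exact Ideal.mul_mem_right _ _ hr
    ext z
    exact this _
  have H := ProjectiveResolution.liftHomotopyZero _ h0
  have h1 := H.comm i
  have h2 : r • f = (resP a t).complex.d i _ ≫ (H.hom ((ComplexShape.down ℕ).next i) i ≫ f) := by
    have : r • f = (r • 𝟙 (resP a t).complex : _ ⟶ _).f i ≫ f := by simp
    rw [this, h1]
    simp only [HomologicalComplex.zero_f, add_zero, Preadditive.add_comp, dNext, prevD]
    have h5 : ∀ j, j = i + 1 → (resP a t).complex.d j i ≫ f = 0 := by rintro j rfl; exact hf
    simp [h5 _ (ChainComplex.prev ℕ i)]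
  have h3 := hfx.smul r
  rw [h2] at h3
  exact h3.eq_zero_of_coboundary

lemma LC_injective [Injective N] : Subsingleton ((localCohomology a (i+1)).obj N) := by
  refine subsingleton_of_forall_eq 0 fun x => ?_
  obtain ⟨t, f, hf, hfx⟩ := LCRel.exists_rep x
  have hex := (resP a t).exact_succ i
  let g := hex.descToInjective f hf
  have hg : (resP a t).complex.d (i+1) i ≫ g = f := hex.comp_descToInjective f hf
  rw [← hg] at hfx
  exact hfx.eq_zero_of_coboundary
end Tors

section TorsMod
open Opposite HomologicalComplex Limits
variable {R : Type u} [CommRing R]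

/-- every element is killed by a power of `a` -/
def IsTors (a : Ideal R) (N : Type u) [AddCommGroup N] [Module R N] : Prop :=
  ∀ x : N, ∃ t : ℕ, ∀ r ∈ a ^ t, r • x = 0

/-- the `a`-torsion submodule -/
def Gam (a : Ideal R) (N : Type u) [AddCommGroup N] [Module R N] : Submodule R N where
  carrier := {x | ∃ t : ℕ, ∀ r ∈ a ^ t, r • x = 0}
  zero_mem' := ⟨0, by simp⟩
  add_mem' := by
    rintro x y ⟨t, ht⟩ ⟨s, hs⟩
    refine ⟨max t s, fun r hr => ?_⟩
    rw [smul_add, ht r (Ideal.pow_le_pow_right (le_max_left _ _) hr),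
      hs r (Ideal.pow_le_pow_right (le_max_right _ _) hr), add_zero]
  smul_mem' := by
    rintro c x ⟨t, ht⟩
    exact ⟨t, fun r hr => by rw [smul_comm, ht r hr, smul_zero]⟩

lemma isTors_Gam (a : Ideal R) (N : Type u) [AddCommGroup N] [Module R N] :
    IsTors a (Gam a N) := by
  rintro ⟨x, t, ht⟩
  exact ⟨t, fun r hr => Subtype.ext (ht r hr)⟩

lemma Gam_uniform (a : Ideal R) (N J : Type u) [AddCommGroup N] [Module R N]
    [AddCommGroup J] [Module R J] [Module.Finite R J] (hN : IsTors a N) (g : J →ₗ[R] N) :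
    ∃ t : ℕ, ∀ r ∈ a ^ t, ∀ x, r • g x = 0 := by
  obtain ⟨s, hs⟩ := (Module.Finite.fg_top : (⊤ : Submodule R J).FG)
  choose T hT using hN
  refine ⟨s.sup (fun x => T (g x)), fun r hr x => ?_⟩
  have hx : x ∈ Submodule.span R (s : Set J) := by rw [hs]; trivial
  induction hx using Submodule.span_induction with
  | mem x hx => exact hT _ r (Ideal.pow_le_pow_right (Finset.le_sup (f := fun x => T (g x)) hx) hr)
  | zero => simp
  | add x y _ _ hx hy => simp [hx, hy]
  | smul c x _ hx => rw [map_smul, smul_comm, hx, smul_zero]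

lemma baer_Gam [IsNoetherianRing R] (a : Ideal R) (E : Type u) [AddCommGroup E] [Module R E]
    (hE : Module.Baer R E) : Module.Baer R (Gam a E) := by
  intro J g
  obtain ⟨t, ht⟩ := Gam_uniform a (Gam a E) J (isTors_Gam a E) g
  obtain ⟨k, hk⟩ := Ideal.exists_pow_inf_eq_pow_smul a (J : Submodule R R)
  have hk := hk (t + k) (by omega)
  rw [Nat.add_sub_cancel] at hk
  have key : ∀ x (hx : x ∈ J), x ∈ a ^ (t + k) → g ⟨x, hx⟩ = 0 := by
    intro x hx hxa
    have h1 : x ∈ a ^ t • J := by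
      have : x ∈ a ^ (t + k) • (⊤ : Submodule R R) ⊓ J := ⟨by simpa using hxa, hx⟩
      rw [hk] at this
      exact Submodule.smul_mono le_rfl inf_le_right this
    have h2 : ∀ y ∈ a ^ t • J, ∀ hy : y ∈ J, g ⟨y, hy⟩ = 0 := by
      intro y hy
      induction hy using Submodule.smul_induction_on' with
      | smul r hr n hn =>
        intro hy
        have : (⟨r • n, hy⟩ : J) = r • ⟨n, hn⟩ := rfl
        rw [this, map_smul, ht r hr]
      | add y hy z hz ihy ihz =>
        intro hyz
        have hyJ : y ∈ J := Submodule.smul_le_right hy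
        have hzJ : z ∈ J := Submodule.smul_le_right hz
        have : (⟨y + z, hyz⟩ : J) = ⟨y, hyJ⟩ + ⟨z, hzJ⟩ := rfl
        rw [this, map_add, ihy, ihz, add_zero]
    exact h2 x h1 hx
  set I := a ^ (t + k)
  let K : Submodule R J := Submodule.comap J.subtype I
  let f : (J ⧸ K) →ₗ[R] (R ⧸ I) := Submodule.mapQ K I J.subtype le_rfl
  have hf : Function.Injective f := by
    rw [← LinearMap.ker_eq_bot]
    exact Submodule.ker_liftQ_eq_bot _ _ _ (by rw [LinearMap.ker_comp, Submodule.ker_mkQ])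
  let g0 : (J ⧸ K) →ₗ[R] E := Submodule.liftQ K ((Gam a E).subtype ∘ₗ g) (by
    intro x hx
    have : g x = 0 := key x.1 x.2 hx
    simp [this])
  obtain ⟨h, hh⟩ := Module.Baer.extension_property hE f hf g0
  refine ⟨LinearMap.codRestrict _ (h ∘ₗ Submodule.mkQ I) (fun x => ⟨t + k, fun r hr => ?_⟩), ?_⟩
  · rw [LinearMap.comp_apply, ← map_smul, ← map_smul]
    have : (Submodule.mkQ I) (r • x) = 0 := by
      rw [Submodule.mkQ_apply, Submodule.Quotient.mk_eq_zero]
      exact Ideal.mul_mem_right _ _ hr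
    rw [this, map_zero]
  · intro x hx
    apply Subtype.ext
    have := LinearMap.congr_fun hh (Submodule.Quotient.mk ⟨x, hx⟩)
    exact this

variable {a : Ideal R}

lemma LC_one_of_tors {S : ShortComplex (ModuleCat.{u} R)} (hS : S.ShortExact)
    [Injective S.X₂] (hT : IsTors a S.X₂) : Subsingleton ((localCohomology a 1).obj S.X₁) := by
  refine subsingleton_of_forall_eq 0 fun x => ?_
  have := hS.epi_g
  have := hS.mono_f
  obtain ⟨t, f, hf, hfx⟩ := LCRel.exists_rep x
  have hex := (resP a t).exact_succ 0
  have hff : (resP a t).complex.d 2 1 ≫ f ≫ S.f = 0 := by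
    rw [← Category.assoc]; erw [hf]; simp
  let g := hex.descToInjective (f ≫ S.f) hff
  have hg : (resP a t).complex.d 1 0 ≫ g = f ≫ S.f := hex.comp_descToInjective _ hff
  have hgc : (resP a t).complex.d 1 0 ≫ (g ≫ S.g) = 0 := by
    rw [← Category.assoc, hg]; simp
  let h : ModuleCat.of R (R ⧸ a ^ t) ⟶ S.X₃ := (resP a t).exact₀.desc (g ≫ S.g) hgc
  have hh : (resP a t).π.f 0 ≫ h = g ≫ S.g := (resP a t).exact₀.g_desc _ hgc
  obtain ⟨y, hy⟩ := (ModuleCat.epi_iff_surjective S.g).1 inferInstance (h.hom (Ideal.Quotient.mk _ 1))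
  obtain ⟨t1, ht1⟩ := hT y
  let t' := max t t1
  have htt : t ≤ t' := le_max_left _ _
  have ht' : ∀ r ∈ a ^ t', r • y = 0 := fun r hr =>
    ht1 r (Ideal.pow_le_pow_right (le_max_right _ _) hr)
  let h' : ModuleCat.of R (R ⧸ a ^ t') ⟶ S.X₂ :=
    ModuleCat.ofHom (Submodule.liftQ (a ^ t') (LinearMap.toSpanSingleton R S.X₂ y) (by
      intro r hr; simpa using ht' r hr))
  have hh' : h' ≫ S.g = trMap a htt ≫ h := by
    refine ModuleCat.hom_ext (LinearMap.ext fun z => ?_)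
    obtain ⟨s, rfl⟩ := Submodule.Quotient.mk_surjective _ z
    change S.g.hom (s • y) = h.hom (Submodule.Quotient.mk s)
    have e : (Submodule.Quotient.mk s : R ⧸ a ^ t) = s • (Ideal.Quotient.mk (a ^ t) 1) := by
      rw [← Ideal.Quotient.mk_eq_mk, ← Submodule.Quotient.mk_smul]; simp
    rw [e, map_smul, map_smul]
    congr 1
  let φ := ProjectiveResolution.lift (trMap a htt) (resP a t') (resP a t)
  have comm : φ.f 0 ≫ (resP a t).π.f 0 = (resP a t').π.f 0 ≫ trMap a htt :=
    ProjectiveResolution.lift_commutes_zero _ _ _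
  let h'' : ((ChainComplex.single₀ (ModuleCat.{u} R)).obj
    (ModuleCat.of R (R ⧸ a ^ t'))).X 0 ⟶ S.X₂ := h'
  let w := φ.f 0 ≫ g - (resP a t').π.f 0 ≫ h''
  have hw : w ≫ S.g = 0 := by
    have e1 : (resP a t').π.f 0 ≫ h'' ≫ S.g = φ.f 0 ≫ g ≫ S.g := by
      rw [← hh]
      erw [hh', ← Category.assoc, ← comm, Category.assoc]
    simp only [w, Preadditive.sub_comp, Category.assoc, e1, sub_self]
  let k := hS.exact.lift _ hw
  have hk : k ≫ S.f = w := hS.exact.lift_f _ hw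
  have hk1 : (resP a t').complex.d 1 0 ≫ k = φ.f 1 ≫ f := by
    rw [← cancel_mono S.f, Category.assoc, hk, Category.assoc, ← hg]
    simp only [w, Preadditive.comp_sub, ← φ.comm_assoc]
    rw [← Category.assoc _ _ h'', ProjectiveResolution.complex_d_comp_π_f_zero, zero_comp, sub_zero]
  have h3 := hfx.map_left htt φ comm
  rw [← hk1] at h3
  exact h3.eq_zero_of_coboundary

lemma mkSE {A B C : Type u} [AddCommGroup A] [AddCommGroup B] [AddCommGroup C]
    [Module R A] [Module R B] [Module R C] (f : A →ₗ[R] B) (g : B →ₗ[R] C)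
    (hf : Function.Injective f) (hg : Function.Surjective g) (h : Function.Exact f g) :
    (ModuleCat.shortComplexOfCompEqZero f g h.linearMap_comp_eq_zero).ShortExact :=
  ModuleCat.shortComplex_shortExact _ h hf hg

theorem LC_of_tors [IsNoetherianRing R] (i : ℕ) : ∀ (N : ModuleCat.{u} R), IsTors a N →
    Subsingleton ((localCohomology a (i+1)).obj N) := by
  have main : ∀ N : ModuleCat.{u} R, IsTors a N → ∃ (E : Type u) (_ : AddCommGroup E)
      (_ : Module R E) (f : N →ₗ[R] E), Function.Injective f ∧ IsTors a E ∧
      Injective (ModuleCat.of R E) := by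
    intro N hN
    let E : ModuleCat.{u} R := Injective.under N
    have h0 : Injective (ModuleCat.of R E) := Injective.injective_under N
    have h1 : Module.Injective R E := Module.injective_module_of_injective_object R E
    have h2 := (baer_Gam a _ (Module.Baer.of_injective h1)).injective
    refine ⟨Gam a E, inferInstance, inferInstance,
      LinearMap.codRestrict _ (Injective.ι N).hom (fun x => ?_), ?_, isTors_Gam _ _,
      Module.injective_object_of_injective_module R _⟩
    · obtain ⟨t, ht⟩ := hN x
      exact ⟨t, fun r hr => by rw [← map_smul, ht r hr, map_zero]⟩
    · intro x y hxy
      exact (ModuleCat.mono_iff_injective (Injective.ι N)).1 inferInstance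
        (congrArg Subtype.val hxy)
  induction i with
  | zero =>
    intro N hN
    obtain ⟨E, _, _, f, hf, hE, hi⟩ := main N hN
    have hS := mkSE f (Submodule.mkQ (LinearMap.range f)) hf (Submodule.mkQ_surjective _)
      f.exact_map_mkQ_range
    exact @LC_one_of_tors _ _ _ _ hS hi hE
  | succ i ih =>
    intro N hN
    obtain ⟨E, _, _, f, hf, hE, hi⟩ := main N hN
    have hS := mkSE f (Submodule.mkQ (LinearMap.range f)) hf (Submodule.mkQ_surjective _)
      f.exact_map_mkQ_range
    have hQ : IsTors a (E ⧸ LinearMap.range f) := by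
      intro x
      obtain ⟨y, rfl⟩ := Submodule.mkQ_surjective _ x
      obtain ⟨t, ht⟩ := hE y
      exact ⟨t, fun r hr => by rw [← map_smul, ht r hr, map_zero]⟩
    have h3 := ih (ModuleCat.of R (E ⧸ LinearMap.range f)) hQ
    have h4 : Subsingleton ((localCohomology a (i+1+1)).obj (ModuleCat.of R E)) := LC_injective
    refine subsingleton_of_forall_eq 0 fun x => ?_
    exact @LC_inj _ _ _ _ _ hS h3 x (Subsingleton.elim (h := h4) _ _)

/-- linear version of the functoriality map -/
def lcMap (a : Ideal R) (i : ℕ) {A B : Type u} [AddCommGroup A] [AddCommGroup B]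
    [Module R A] [Module R B] (f : A →ₗ[R] B) :
    (localCohomology a i).obj (ModuleCat.of R A) →ₗ[R]
      (localCohomology a i).obj (ModuleCat.of R B) :=
  ((localCohomology a i).map (ModuleCat.ofHom f)).hom

section lcMap
variable (a : Ideal R) (i : ℕ) {A B C : Type u} [AddCommGroup A] [AddCommGroup B] [AddCommGroup C]
    [Module R A] [Module R B] [Module R C] (f : A →ₗ[R] B) (g : B →ₗ[R] C)

lemma lcMap_id : lcMap a i (LinearMap.id : A →ₗ[R] A) = LinearMap.id :=
  LinearMap.ext fun x => LC_map_id x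

lemma lcMap_comp : lcMap a i (g ∘ₗ f) = lcMap a i g ∘ₗ lcMap a i f :=
  LinearMap.ext fun x => LC_map_comp (ModuleCat.ofHom f) (ModuleCat.ofHom g) x

lemma lcMap_smul (r : R) : lcMap a i (r • f) = r • lcMap a i f :=
  LinearMap.ext fun x => LC_map_smul r (ModuleCat.ofHom f) x

lemma lcMap_zero : lcMap a i (0 : A →ₗ[R] B) = 0 :=
  LinearMap.ext fun x => LC_map_zero x

lemma lcMap_add (f' : A →ₗ[R] B) : lcMap a i (f + f') = lcMap a i f + lcMap a i f' :=
  LinearMap.ext fun x => LC_map_add (ModuleCat.ofHom f) (ModuleCat.ofHom f') x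

lemma lcMap_sum {ι : Type*} (s : Finset ι) (F : ι → (A →ₗ[R] B)) :
    lcMap a i (∑ j ∈ s, F j) = ∑ j ∈ s, lcMap a i (F j) := by
  classical
  induction s using Finset.induction_on with
  | empty => simp [lcMap_zero]
  | insert j s hj ih => rw [Finset.sum_insert hj, Finset.sum_insert hj, lcMap_add, ih]

variable {f g}

lemma lcMap_surj (hf : Function.Injective f) (hg : Function.Surjective g)
    (h : Function.Exact f g)
    (hA : Subsingleton ((localCohomology a (i+1)).obj (ModuleCat.of R A))) :
    Function.Surjective (lcMap a i g) :=
  @LC_surj _ _ _ _ _ (mkSE f g hf hg h) hA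

lemma lcMap_exact (hf : Function.Injective f) (hg : Function.Surjective g)
    (h : Function.Exact f g) (x : (localCohomology a i).obj (ModuleCat.of R B))
    (hx : lcMap a i g x = 0) : ∃ y, lcMap a i f y = x :=
  LC_exact (mkSE f g hf hg h) x hx

lemma lcMap_inj (hf : Function.Injective f) (hg : Function.Surjective g)
    (h : Function.Exact f g)
    (hC : Subsingleton ((localCohomology a i).obj (ModuleCat.of R C))) :
    Function.Injective (lcMap a (i+1) f) := by
  rw [injective_iff_map_eq_zero]
  exact @LC_inj _ _ _ _ _ (mkSE f g hf hg h) hC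
end lcMap

end TorsMod

section Vanish
open scoped Pointwise
variable {R : Type u} [CommRing R]

lemma lc_subsingleton (a : Ideal R) (i : ℕ) (N : Type u) [AddCommGroup N] [Module R N]
    [Subsingleton N] : Subsingleton ((localCohomology a i).obj (ModuleCat.of R N)) := by
  refine subsingleton_of_forall_eq 0 fun x => ?_
  have h : (LinearMap.id : N →ₗ[R] N) = 0 := Subsingleton.elim _ _
  have h2 := lcMap_id a i (A := N) (R := R)
  rw [h, lcMap_zero] at h2
  exact (LinearMap.congr_fun h2 x).symm

/-- `a`-torsion free modules have an `a`-regular element -/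
lemma exists_regular [IsNoetherianRing R] (a : Ideal R) (N : Type u) [AddCommGroup N] [Module R N]
    [Module.Finite R N] (h : ∀ y : N, (∀ r ∈ a, r • y = 0) → y = 0) :
    ∃ x ∈ a, IsSMulRegular N x := by
  by_contra! hc
  have h1 : (a : Set R) ⊆ ⋃ p ∈ associatedPrimes R N, (p : Set R) := by
    rw [biUnion_associatedPrimes_eq_compl_regular]
    exact fun x hx => hc x hx
  have h2 := (Ideal.subset_union_prime_finite (associatedPrimes.finite R N) (f := id) ⊥ ⊥
    (fun p hp _ _ => hp.isPrime)).1 h1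
  obtain ⟨p, hp, hap⟩ := h2
  obtain ⟨hpp, y, hy⟩ := (isAssociatedPrime_iff).1 hp
  have hy0 : y = 0 := h y fun r hr => by
    have : r ∈ p := hap hr
    rw [hy] at this
    simpa using this
  apply hpp.ne_top
  rw [hy, hy0, Ideal.eq_top_iff_one]
  simp

lemma vanish_aux {d : WithBot ℕ∞} {i : ℕ} (h : d + 1 < ((i + 1 : ℕ) : WithBot ℕ∞)) :
    d < (i : WithBot ℕ∞) := by
  by_contra hc
  rw [not_lt] at hc
  refine absurd h (not_lt.2 ?_)
  push_cast
  gcongr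

/-- Grothendieck vanishing -/
theorem lc_vanish [IsNoetherianRing R] (a : Ideal R) (i : ℕ) :
    ∀ (N : Type u) [AddCommGroup N] [Module R N] [Module.Finite R N],
    Module.supportDim R N < (i : WithBot ℕ∞) →
    Subsingleton ((localCohomology a i).obj (ModuleCat.of R N)) := by
  induction i with
  | zero =>
    intro N _ _ _ h
    have : Subsingleton N := by
      rw [← Module.supportDim_eq_bot_iff_subsingleton R]
      by_contra hb
      obtain ⟨d, hd⟩ := WithBot.ne_bot_iff_exists.1 hb
      rw [← hd] at h
      exact absurd (WithBot.coe_lt_coe.1 h) (by simp)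
    exact lc_subsingleton a 0 N
  | succ i ih =>
    intro N _ _ _ h
    let N' := N ⧸ Gam a N
    have htf : ∀ y : N', (∀ r ∈ a, r • y = 0) → y = 0 := by
      intro y hy
      obtain ⟨z, rfl⟩ := Submodule.mkQ_surjective _ y
      let g : a →ₗ[R] Gam a N := LinearMap.codRestrict _
        ((LinearMap.toSpanSingleton R N z) ∘ₗ a.subtype) (fun r => by
          have := hy r.1 r.2
          rw [← map_smul, Submodule.mkQ_apply, Submodule.Quotient.mk_eq_zero] at this
          exact this)
      obtain ⟨t, ht⟩ := Gam_uniform a (Gam a N) a (isTors_Gam a N) g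
      rw [Submodule.mkQ_apply, Submodule.Quotient.mk_eq_zero]
      refine ⟨t + 1, fun r hr => ?_⟩
      rw [pow_succ] at hr
      induction hr using Submodule.mul_induction_on' with
      | mem_mul_mem r hr s hs =>
        have := congrArg Subtype.val (ht r hr ⟨s, hs⟩)
        rw [mul_smul]
        exact this
      | add r hr s hs h1 h2 => rw [add_smul, h1, h2, add_zero]
    obtain ⟨x, hxa, hx⟩ := exists_regular a N' htf
    have hd : Module.supportDim R (QuotSMulTop x N') < (i : WithBot ℕ∞) := by
      apply vanish_aux
      exact ((Module.supportDim_quotSMulTop_succ_le_of_notMem_minimalPrimes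
        (fun _ => hx.notMem_of_mem_minimalPrimes)).trans
        (Module.supportDim_le_of_surjective _ (Submodule.mkQ_surjective (Gam a N)))).trans_lt h
    have hq := ih _ hd
    have hex : Function.Exact (LinearMap.lsmul R N' x) (Submodule.mkQ (x • (⊤ : Submodule R N'))) := by
      intro z
      rw [Submodule.mkQ_apply, Submodule.Quotient.mk_eq_zero]
      simp [Submodule.mem_smul_pointwise_iff_exists]
    have hinj := lcMap_inj a i (f := LinearMap.lsmul R N' x) hx (Submodule.mkQ_surjective _) hex hq
    have hxe : LinearMap.lsmul R N' x = x • LinearMap.id := LinearMap.ext fun _ => rfl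
    rw [hxe, lcMap_smul, lcMap_id] at hinj
    have hN' : Subsingleton ((localCohomology a (i+1)).obj (ModuleCat.of R N')) := by
      refine subsingleton_of_forall_eq 0 fun y => ?_
      obtain ⟨t, ht⟩ := LC_torsion y
      have hxt := ht (x ^ t) (Ideal.pow_mem_pow hxa t)
      clear ht
      induction t with
      | zero => simpa using hxt
      | succ t iht =>
        apply iht
        apply hinj
        rw [map_zero]
        rw [pow_succ', mul_smul] at hxt
        exact hxt
    have hΓ := LC_of_tors i (ModuleCat.of R (Gam a N)) (isTors_Gam a N)
    refine subsingleton_of_forall_eq 0 fun y => ?_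
    obtain ⟨z, rfl⟩ := lcMap_exact a (i+1) (f := (Gam a N).subtype) (g := (Gam a N).mkQ)
      Subtype.val_injective (Submodule.mkQ_surjective _) (LinearMap.exact_subtype_mkQ _) y
      (Subsingleton.elim _ _)
    rw [Subsingleton.elim z 0, map_zero]

end Vanish

section Main
open scoped Pointwise
variable {R : Type u} [CommRing R]

lemma dim_le_of_ann {M N : Type u} [AddCommGroup M] [Module R M] [AddCommGroup N] [Module R N]
    [Module.Finite R M] [Module.Finite R N]
    (h : Module.annihilator R M ≤ Module.annihilator R N) :
    Module.supportDim R N ≤ Module.supportDim R M := by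
  refine Order.krullDim_le_of_strictMono (fun q => ⟨q.1, ?_⟩) (fun _ _ lt => lt)
  have := q.2
  rw [Module.mem_support_iff_of_finite] at this ⊢
  exact h.trans this

lemma dim_pi_le (M : Type u) [AddCommGroup M] [Module R M] [Module.Finite R M] (k : ℕ) :
    Module.supportDim R (Fin k → M) ≤ Module.supportDim R M := by
  apply dim_le_of_ann
  intro r hr
  rw [Module.mem_annihilator] at hr ⊢
  intro m
  funext j
  exact hr (m j)

variable [IsNoetherianRing R] (a : Ideal R) (n : ℕ)

lemma lc_surj_of_dim {B C : Type u} [AddCommGroup B] [Module R B] [AddCommGroup C] [Module R C]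
    [Module.Finite R B] (hB : Module.supportDim R B ≤ (n : WithBot ℕ∞)) (g : B →ₗ[R] C)
    (hg : Function.Surjective g) : Function.Surjective (lcMap a n g) := by
  refine lcMap_surj a n (f := (LinearMap.ker g).subtype) Subtype.val_injective hg
    (LinearMap.exact_subtype_ker_map g) (lc_vanish a (n+1) _ ?_)
  refine ((Module.supportDim_le_of_injective (LinearMap.ker g).subtype
    Subtype.val_injective).trans hB).trans_lt ?_
  exact_mod_cast Nat.lt_succ_self n

lemma dim_aux {d : WithBot ℕ∞} (h : d + 1 ≤ (n : WithBot ℕ∞)) : d < (n : WithBot ℕ∞) := by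
  apply vanish_aux
  refine h.trans_lt ?_
  exact_mod_cast Nat.lt_succ_self n

lemma lc_to_domain_surj {M : Type u} [AddCommGroup M] [Module R M] [Module.Finite R M]
    (hM : Module.supportDim R M ≤ (n : WithBot ℕ∞)) (p : Ideal R) [p.IsPrime]
    (hp : Module.supportDim R (R ⧸ p) ≤ (n : WithBot ℕ∞)) (h : M →ₗ[R] (R ⧸ p)) (h0 : h ≠ 0) :
    Function.Surjective (lcMap a n h) := by
  have e : h = (LinearMap.range h).subtype ∘ₗ h.rangeRestrict := rfl
  rw [e, lcMap_comp]
  rw [LinearMap.coe_comp]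
  refine Function.Surjective.comp ?_ (lc_surj_of_dim a n hM _ h.surjective_rangeRestrict)
  obtain ⟨m, hm⟩ : ∃ m, h m ≠ 0 := by
    by_contra! hc
    exact h0 (LinearMap.ext hc)
  obtain ⟨r, hr⟩ := Ideal.Quotient.mk_surjective (h m)
  have hreg : IsSMulRegular (R ⧸ p) r := by
    rw [isSMulRegular_iff_right_eq_zero_of_smul]
    intro x hx
    rw [Algebra.smul_def] at hx
    rcases mul_eq_zero.1 hx with h1 | h1
    · exact absurd (hr.symm.trans h1) hm
    · exact h1
  have hle : r • (⊤ : Submodule R (R ⧸ p)) ≤ LinearMap.range h := by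
    intro z hz
    obtain ⟨y, -, rfl⟩ := (Submodule.mem_smul_pointwise_iff_exists _ _ _).1 hz
    obtain ⟨s, rfl⟩ := Ideal.Quotient.mk_surjective y
    refine ⟨s • m, ?_⟩
    rw [map_smul, ← hr, Algebra.smul_def, Algebra.smul_def]
    exact mul_comm _ _
  have hd : Module.supportDim R ((R ⧸ p) ⧸ LinearMap.range h) < (n : WithBot ℕ∞) := by
    refine lt_of_le_of_lt (Module.supportDim_le_of_surjective (Submodule.factor hle)
      (Submodule.factor_surjective hle)) ?_
    apply dim_aux
    exact (Module.supportDim_quotSMulTop_succ_le_of_notMem_minimalPrimes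
        (fun _ => hreg.notMem_of_mem_minimalPrimes)).trans hp
  have hs := lc_vanish a n _ hd
  intro y
  exact lcMap_exact a n (f := (LinearMap.range h).subtype) (g := (LinearMap.range h).mkQ)
      Subtype.val_injective (Submodule.mkQ_surjective _) (LinearMap.exact_subtype_mkQ _) y
      (Subsingleton.elim _ _)

lemma exists_hom_ne_zero {M : Type u} [AddCommGroup M] [Module R M] [Module.Finite R M]
    (p : Ideal R) [p.IsPrime] (h : Module.annihilator R M ≤ p) :
    ∃ f : M →ₗ[R] (R ⧸ p), f ≠ 0 := by
  by_contra! hc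
  have : Subsingleton (M →ₗ[R] (R ⧸ p)) := subsingleton_of_forall_eq 0 hc
  obtain ⟨r, hr, hreg⟩ := IsSMulRegular.subsingleton_linearMap_iff.1 this
  have h1 : r • (1 : R ⧸ p) = 0 := by
    rw [Algebra.smul_def, mul_one]
    exact Ideal.Quotient.eq_zero_iff_mem.2 (h hr)
  exact one_ne_zero (hreg.right_eq_zero_of_smul h1)

lemma lc_ann_le (a : Ideal R) (n : ℕ) (M : Type u) [AddCommGroup M] [Module R M] :
    Module.annihilator R M ≤ Module.annihilator R (LC a n M) := by
  intro r hr
  rw [Module.mem_annihilator] at hr ⊢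
  intro x
  have h : r • (LinearMap.id : M →ₗ[R] M) = 0 := LinearMap.ext fun m => hr m
  have h2 := lcMap_smul a n (LinearMap.id : M →ₗ[R] M) r
  rw [h, lcMap_zero, lcMap_id] at h2
  exact (LinearMap.congr_fun h2 x).symm

lemma lc_ann_domain (p : Ideal R) [p.IsPrime]
    (hp : Module.supportDim R (R ⧸ p) ≤ (n : WithBot ℕ∞)) (hn : Nontrivial (LC a n (R ⧸ p))) :
    Module.annihilator R (LC a n (R ⧸ p)) = p := by
  apply le_antisymm
  · intro r hr
    by_contra hrp
    have hne : r • (LinearMap.id : (R ⧸ p) →ₗ[R] (R ⧸ p)) ≠ 0 := by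
      intro h
      have := LinearMap.congr_fun h 1
      rw [LinearMap.smul_apply, LinearMap.id_apply, Algebra.smul_def, mul_one] at this
      exact hrp (Ideal.Quotient.eq_zero_iff_mem.1 this)
    have hs := lc_to_domain_surj a n hp p hp _ hne
    rw [lcMap_smul, lcMap_id] at hs
    obtain ⟨x, hx⟩ := exists_ne (0 : LC a n (R ⧸ p))
    obtain ⟨y, hy⟩ := hs x
    exact hx (hy.symm.trans (Module.mem_annihilator.1 hr y))
  · refine le_trans ?_ (lc_ann_le a n (R ⧸ p))
    rw [Ideal.annihilator_quotient]

lemma lc_pi_subsingleton (N : Type u) [AddCommGroup N] [Module R N] (k : ℕ)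
    (h : Subsingleton (LC a n N)) : Subsingleton (LC a n (Fin k → N)) := by
  refine subsingleton_of_forall_eq 0 fun x => ?_
  have e : (LinearMap.id : (Fin k → N) →ₗ[R] (Fin k → N)) =
      ∑ j, LinearMap.single R (fun _ => N) j ∘ₗ LinearMap.proj j := by
    refine LinearMap.ext fun m => ?_
    funext l
    simp [LinearMap.sum_apply, Finset.sum_apply, Pi.single_apply]
  have h2 := lcMap_id a n (A := Fin k → N) (R := R)
  rw [e, lcMap_sum] at h2
  rw [← LinearMap.id_apply (R := R) x, ← h2, LinearMap.sum_apply]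
  refine Finset.sum_eq_zero fun j _ => ?_
  rw [lcMap_comp, LinearMap.comp_apply,
    Subsingleton.elim (h := h) (lcMap a n (LinearMap.proj j) x) 0, map_zero]

/-- modules killed by `p` -/
lemma lc_killed (p : Ideal R) (hp : Module.supportDim R (R ⧸ p) ≤ (n : WithBot ℕ∞))
    (h0 : Subsingleton (LC a n (R ⧸ p))) (Q : Type u) [AddCommGroup Q] [Module R Q]
    [Module.Finite R Q] (hQ : ∀ r ∈ p, ∀ x : Q, r • x = 0) : Subsingleton (LC a n Q) := by
  obtain ⟨k, s, hs⟩ := Module.Finite.exists_fin (R := R) (M := Q)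
  let φ : Fin k → ((R ⧸ p) →ₗ[R] Q) := fun j =>
    Submodule.liftQ p (LinearMap.toSpanSingleton R Q (s j)) (fun r hr => by
      rw [LinearMap.mem_ker, LinearMap.toSpanSingleton_apply]; exact hQ r hr _)
  let Φ : (Fin k → (R ⧸ p)) →ₗ[R] Q := LinearMap.lsum R (fun _ => R ⧸ p) R φ
  have hΦ : Function.Surjective Φ := by
    rw [← LinearMap.range_eq_top, eq_top_iff, ← hs, Submodule.span_le]
    rintro _ ⟨j, rfl⟩
    refine ⟨Pi.single j 1, ?_⟩
    have h1 : Φ (Pi.single j 1) = φ j 1 := by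
      simp only [Φ, LinearMap.lsum_apply, LinearMap.sum_apply, LinearMap.comp_apply,
        LinearMap.proj_apply]
      rw [Finset.sum_eq_single j]
      · simp
      · intro b _ hb
        rw [Pi.single_eq_of_ne hb, map_zero]
      · simp
    rw [h1]
    change (1 : R) • s j = s j
    rw [one_smul]
  have hsurj := lc_surj_of_dim a n ((dim_pi_le (R ⧸ p) k).trans hp) Φ hΦ
  have := lc_pi_subsingleton a n (R ⧸ p) k h0
  exact hsurj.subsingleton

lemma lc_att_le {M : Type u} [AddCommGroup M] [Module R M] [Module.Finite R M]
    (hM : Module.supportDim R M ≤ (n : WithBot ℕ∞)) (p : Ideal R)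
    (hp : Module.supportDim R (R ⧸ p) ≤ (n : WithBot ℕ∞))
    (h0 : Subsingleton (LC a n (R ⧸ p))) (U : Submodule R (LC a n M))
    (hU : p ≤ Module.annihilator R (LC a n M ⧸ U)) : U = ⊤ := by
  obtain ⟨k, s, hs⟩ := Submodule.fg_iff_exists_fin_generating_family.1
    (IsNoetherian.noetherian p)
  have hsp : ∀ j, s j ∈ p := fun j => by rw [← hs]; exact Submodule.subset_span ⟨j, rfl⟩
  let φ : (Fin k → M) →ₗ[R] M := ∑ j, s j • LinearMap.proj j
  have hQ : ∀ r ∈ p, ∀ x : M ⧸ LinearMap.range φ, r • x = 0 := by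
    intro r hr x
    obtain ⟨m, rfl⟩ := Submodule.mkQ_surjective _ x
    rw [← hs] at hr
    induction hr using Submodule.span_induction with
    | mem r hr =>
      obtain ⟨j, rfl⟩ := hr
      rw [← map_smul, Submodule.mkQ_apply, Submodule.Quotient.mk_eq_zero]
      refine ⟨Pi.single j m, ?_⟩
      simp only [φ, LinearMap.sum_apply, LinearMap.smul_apply, LinearMap.proj_apply]
      rw [Finset.sum_eq_single j]
      · simp
      · intro b _ hb
        rw [Pi.single_eq_of_ne hb, smul_zero]
      · simp
    | zero => simp
    | add r t _ _ h1 h2 => rw [add_smul, h1, h2, add_zero]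
    | smul c r _ h1 => rw [smul_assoc, h1, smul_zero]
  have h1 := lc_killed a n p hp h0 _ hQ
  rw [eq_top_iff]
  rintro x -
  obtain ⟨y, rfl⟩ := lcMap_exact a n (f := (LinearMap.range φ).subtype)
    (g := (LinearMap.range φ).mkQ) Subtype.val_injective (Submodule.mkQ_surjective _)
    (LinearMap.exact_subtype_mkQ _) x (Subsingleton.elim (h := h1) _ _)
  obtain ⟨z, rfl⟩ := lc_surj_of_dim a n ((dim_pi_le M k).trans hM) φ.rangeRestrict
    φ.surjective_rangeRestrict y
  rw [← LinearMap.comp_apply, ← lcMap_comp]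
  have e : (LinearMap.range φ).subtype ∘ₗ φ.rangeRestrict = ∑ j, s j • LinearMap.proj j := rfl
  rw [e, lcMap_sum, LinearMap.sum_apply]
  refine Submodule.sum_mem _ fun j _ => ?_
  rw [lcMap_smul, LinearMap.smul_apply, ← Submodule.Quotient.mk_eq_zero,
    Submodule.Quotient.mk_smul]
  exact Module.mem_annihilator.1 (hU (hsp j)) _

end Main

theorem stmt0 (R : Type u) [CommRing R] [IsNoetherianRing R] [IsLocalRing R]
    (a : Ideal R) (ha : a ≠ ⊤) (M : Type u) [AddCommGroup M] [Module R M]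
    [Module.Finite R M] (n : ℕ) (hdim : mdim R M = (n : ℕ∞)) :
    Att R (LC a n M) =
      { p : Ideal R | ∃ hp : p.IsPrime,
        (⟨p, hp⟩ : PrimeSpectrum R) ∈ Module.support R M ∧
        Nontrivial (LC a n (R ⧸ p)) } := by
  have hM : Module.supportDim R M ≤ (n : WithBot ℕ∞) := le_of_eq hdim
  have hdom : ∀ p : Ideal R, Module.annihilator R M ≤ p →
      Module.supportDim R (R ⧸ p) ≤ (n : WithBot ℕ∞) := fun p hp =>
    (dim_le_of_ann (by rwa [Ideal.annihilator_quotient])).trans hM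
  ext p
  constructor
  · rintro ⟨hp, U, hU⟩
    have h1 : Module.annihilator R M ≤ p := by
      rw [hU]
      exact (lc_ann_le a n M).trans
        (LinearMap.annihilator_le_of_surjective U.mkQ U.mkQ_surjective)
    refine ⟨hp, Module.mem_support_iff_of_finite.2 h1, ?_⟩
    by_contra hc
    rw [not_nontrivial_iff_subsingleton] at hc
    have h2 := lc_att_le a n hM p (hdom p h1) hc U hU.le
    apply hp.ne_top
    rw [hU, Ideal.eq_top_iff_one, Module.mem_annihilator]
    intro x
    obtain ⟨y, rfl⟩ := U.mkQ_surjective x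
    rw [one_smul, Submodule.mkQ_apply, Submodule.Quotient.mk_eq_zero, h2]
    trivial
  · rintro ⟨hp, hsupp, hnt⟩
    have h1 : Module.annihilator R M ≤ p := Module.mem_support_iff_of_finite.1 hsupp
    obtain ⟨h, hne⟩ := exists_hom_ne_zero p h1
    have hs := lc_to_domain_surj a n hM p (hdom p h1) h hne
    refine ⟨hp, LinearMap.ker (lcMap a n h), ?_⟩
    rw [(LinearMap.quotKerEquivOfSurjective _ hs).annihilator_eq]
    exact (lc_ann_domain a n p (hdom p h1) hnt).symm

end
end

section
/- Let (R, m) be a commutative Noetherian local ring, a an ideal of R, and M a finitely generated R-module of dimension n. Every attached prime of H_a^n(M) is an associated prime of M; more precisely, Att(H_a^n(M)) ⊆ { p ∈ Ass(M) : dim(R/p) = n }. -/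
noncomputable section

universe u

open CategoryTheory

/-- Cohomological dimension of `M` with respect to `J`:
the supremum of the `i` with `H_J^i(M) ≠ 0` (`⊥` if there are none). -/
def cohDim (R : Type u) [CommRing R] (J : Ideal R) (M : Type u)
    [AddCommGroup M] [Module R M] : WithBot ℕ∞ :=
  sSup { x | ∃ i : ℕ, x = (i : ℕ∞) ∧ Nontrivial (LC J i M) }

namespace LCaux
open scoped Pointwise
variable {R : Type u} [CommRing R]

lemma mkSES {A B C : Type u} [AddCommGroup A] [Module R A] [AddCommGroup B] [Module R B]
    [AddCommGroup C] [Module R C] (f : A →ₗ[R] B) (g : B →ₗ[R] C)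
    (hf : Function.Injective f) (hg : Function.Surjective g) (h : Function.Exact f g) :
    (ShortComplex.mk (ModuleCat.ofHom f) (ModuleCat.ofHom g)
      (by ext x; exact h.apply_apply_eq_zero x)).ShortExact where
  exact := by
    rw [ShortComplex.moduleCat_exact_iff]
    intro x hx
    exact (h x).1 hx
  mono_f := (ModuleCat.mono_iff_injective _).2 hf
  epi_g := (ModuleCat.epi_iff_surjective _).2 hg

/-- The short complex of a short exact sequence. -/
abbrev scOf {S : ShortComplex (ModuleCat.{u} R)} (_ : S.ShortExact) :
    ShortComplex (ModuleCat.{u} R) := S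

/-- pullback in the first variable -/
abbrev pull {X Y : ModuleCat.{u} R} (φ : X ⟶ Y) {N : ModuleCat.{u} R} {i : ℕ}
    (x : Abelian.Ext Y N i) : Abelian.Ext X N i :=
  (Abelian.Ext.mk₀ φ).comp x (zero_add i)

/-- pushforward in the second variable -/
abbrev push {X N N' : ModuleCat.{u} R} {i : ℕ}
    (x : Abelian.Ext X N i) (φ : N ⟶ N') : Abelian.Ext X N' i :=
  x.comp (Abelian.Ext.mk₀ φ) (add_zero i)

lemma pull_pull {X Y Z : ModuleCat.{u} R} (φ : X ⟶ Y) (ψ : Y ⟶ Z) {N : ModuleCat.{u} R} {i : ℕ}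
    (x : Abelian.Ext Z N i) : pull φ (pull ψ x) = pull (φ ≫ ψ) x := by
  simp [pull]

lemma pull_push {X Y : ModuleCat.{u} R} (φ : X ⟶ Y) {N N' : ModuleCat.{u} R} {i : ℕ}
    (x : Abelian.Ext Y N i) (ψ : N ⟶ N') : pull φ (push x ψ) = push (pull φ x) ψ := by
  simp [pull, push]

lemma push_push {X : ModuleCat.{u} R} {N N' N'' : ModuleCat.{u} R} {i : ℕ}
    (x : Abelian.Ext X N i) (φ : N ⟶ N') (ψ : N' ⟶ N'') :
    push (push x φ) ψ = push x (φ ≫ ψ) := by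
  simp [push]

lemma pull_comp {X Y : ModuleCat.{u} R} (φ : X ⟶ Y) {N N' : ModuleCat.{u} R} {i j k : ℕ}
    (x : Abelian.Ext Y N i) (y : Abelian.Ext N N' j) (h : i + j = k) :
    pull φ (x.comp y h) = (pull φ x).comp y h := by
  simp only [pull]
  rw [Abelian.Ext.comp_assoc]
  omega

lemma pull_extClass {S₁ S₂ : ShortComplex (ModuleCat.{u} R)} (h₁ : S₁.ShortExact)
    (h₂ : S₂.ShortExact) (f : S₁ ⟶ S₂) {N : ModuleCat.{u} R} {i j : ℕ}
    (x : Abelian.Ext S₂.X₁ N i) (h : 1 + i = j) :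
    pull f.τ₃ (h₂.extClass.comp x h) = h₁.extClass.comp (pull f.τ₁ x) h := by
  rw [pull_comp]
  simp only [pull]
  rw [← ShortComplex.ShortExact.extClass_naturality h₁ h₂ f, Abelian.Ext.comp_assoc]
  omega

lemma pull_factor {X Z : Type u} [AddCommGroup X] [Module R X] [AddCommGroup Z] [Module R Z]
    (W : Submodule R X) (f : Z →ₗ[R] X) (hf : ∀ z, f z ∈ W) {N : ModuleCat.{u} R} {i : ℕ}
    (x : Abelian.Ext (ModuleCat.of R X) N i) (h : pull (ModuleCat.ofHom W.subtype) x = 0) :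
    pull (ModuleCat.ofHom f) x = 0 := by
  have : ModuleCat.ofHom f = ModuleCat.ofHom (f.codRestrict W hf) ≫ ModuleCat.ofHom W.subtype := rfl
  rw [this, ← pull_pull, h]
  simp [pull]

section tors
variable [IsNoetherianRing R]

lemma tors_aux (a : Ideal R) (k : ℕ) (N : ModuleCat.{u} R)
    (hN : ∀ r ∈ a ^ k, ∀ x : N, r • x = 0) (i : ℕ) :
    ∀ (X : Type u) [AddCommGroup X] [Module R X] [Module.Finite R X],
      ∃ s, ∀ x : Abelian.Ext (ModuleCat.of R X) N i,
        pull (ModuleCat.ofHom (a ^ s • ⊤ : Submodule R X).subtype) x = 0 := by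
  induction i with
  | zero =>
    intro X _ _ _
    refine ⟨k, fun x => ?_⟩
    obtain ⟨f, rfl⟩ := (Abelian.Ext.mk₀_bijective _ _).2 x
    simp only [pull, Abelian.Ext.mk₀_comp_mk₀]
    rw [← Abelian.Ext.mk₀_zero]
    congr 1
    ext ⟨y, hy⟩
    change f y = 0
    refine Submodule.smul_induction_on hy (fun r hr n _ => ?_) (fun x y hx hy => ?_)
    · rw [map_smul]; exact hN r hr _
    · rw [map_add, hx, hy, add_zero]
  | succ i ih =>
    intro X _ _ _
    obtain ⟨m, g, hg⟩ := Module.Finite.exists_fin' R X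
    obtain ⟨s, hs⟩ := ih (LinearMap.ker g)
    obtain ⟨c, hc⟩ := Ideal.exists_pow_inf_eq_pow_smul a (LinearMap.ker g)
    refine ⟨s + c, fun x => ?_⟩
    have h₂ := mkSES (LinearMap.ker g).subtype g (Subtype.val_injective) hg
      (LinearMap.exact_subtype_ker_map g)
    let aF : Submodule R (Fin m → R) := a ^ (s + c) • ⊤
    let aX : Submodule R X := a ^ (s + c) • ⊤
    have hmap : aF.map g = aX := by
      simp only [aF, aX, Submodule.map_smul'', Submodule.map_top, LinearMap.range_eq_top.2 hg]
    have hle : aF ⊓ LinearMap.ker g ≤ aF := inf_le_left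
    let g' : aF →ₗ[R] aX := g.restrict (fun y hy => hmap ▸ Submodule.mem_map_of_mem hy)
    have hg' : Function.Surjective g' := by
      rintro ⟨y, hy⟩
      rw [← hmap] at hy
      obtain ⟨z, hz, rfl⟩ := hy
      exact ⟨⟨z, hz⟩, rfl⟩
    have h₁ := mkSES (Submodule.inclusion hle) g' (Submodule.inclusion_injective _) hg' (by
      rintro ⟨y, hy⟩
      constructor
      · intro h
        exact ⟨⟨y, hy, congrArg Subtype.val h⟩, rfl⟩
      · rintro ⟨⟨z, hz⟩, h⟩
        obtain rfl : z = y := congrArg Subtype.val h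
        exact Subtype.ext hz.2)
    let φ : scOf h₁ ⟶ scOf h₂ :=
      { τ₁ := ModuleCat.ofHom (Submodule.inclusion inf_le_right)
        τ₂ := ModuleCat.ofHom aF.subtype
        τ₃ := ModuleCat.ofHom aX.subtype
        comm₁₂ := rfl
        comm₂₃ := rfl }
    have hz : pull (ModuleCat.ofHom g) x = 0 := by
      have : Projective (ModuleCat.of R (Fin m → R)) :=
        (IsProjective.iff_projective _).1 inferInstance
      exact Abelian.Ext.eq_zero_of_projective _
    obtain ⟨x₁, rfl⟩ := Abelian.Ext.contravariant_sequence_exact₃ h₂ _ x hz (add_comm 1 i)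
    have := pull_extClass h₁ h₂ φ x₁ (add_comm 1 i)
    refine this.trans ?_
    have hK : ∀ y : (aF ⊓ LinearMap.ker g : Submodule R _),
        Submodule.inclusion (inf_le_right : aF ⊓ LinearMap.ker g ≤ LinearMap.ker g) y ∈
          (a ^ s • ⊤ : Submodule R (LinearMap.ker g)) := by
      rintro ⟨y, hy⟩
      have h3 : y ∈ (a ^ s • ⊤ : Submodule R (LinearMap.ker g)).map
          (LinearMap.ker g).subtype := by
        rw [Submodule.map_smul'', Submodule.map_top, Submodule.range_subtype]
        have h4 := hc (s + c) (by omega)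
        rw [Nat.add_sub_cancel] at h4
        rw [h4] at hy
        exact (Submodule.smul_mono le_rfl inf_le_right :
          a ^ s • (a ^ c • ⊤ ⊓ LinearMap.ker g) ≤ a ^ s • LinearMap.ker g) hy
      obtain ⟨z, hz, rfl⟩ := h3
      exact hz
    have h6 : pull φ.τ₁ x₁ = 0 := pull_factor _ _ hK x₁ (hs x₁)
    rw [h6]
    simp

end tors

/-- The transition map `R/a^s → R/a^t`. -/
def Q (a : Ideal R) {t s : ℕ} (h : t ≤ s) :
    ModuleCat.of R (R ⧸ a ^ s) ⟶ ModuleCat.of R (R ⧸ a ^ t) :=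
  ModuleCat.ofHom (Submodule.mapQ _ _ LinearMap.id (Ideal.pow_le_pow_right h))

lemma Q_comp (a : Ideal R) {t s v : ℕ} (h : t ≤ s) (h' : s ≤ v) :
    Q a h' ≫ Q a h = Q a (h.trans h') := by
  refine ModuleCat.hom_ext (LinearMap.ext fun x => ?_)
  obtain ⟨x, rfl⟩ := Submodule.Quotient.mk_surjective _ x
  rfl

/-- Elementwise vanishing of `H^i_a(N)`. -/
def Van (a : Ideal R) (i : ℕ) (N : ModuleCat.{u} R) : Prop :=
  ∀ (t : ℕ) (x : Abelian.Ext (ModuleCat.of R (R ⧸ a ^ t)) N i),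
    ∃ (s : ℕ) (h : t ≤ s), pull (Q a h) x = 0

lemma van_tors [IsNoetherianRing R] (a : Ideal R) (k : ℕ) (N : ModuleCat.{u} R)
    (hN : ∀ r ∈ a ^ k, ∀ x : N, r • x = 0) (i : ℕ) : Van a (i + 1) N := by
  intro t x
  obtain ⟨s, hs⟩ := tors_aux a k N hN i (a ^ t : Ideal R)
  refine ⟨t + s, by omega, ?_⟩
  have hses (t : ℕ) := mkSES (Submodule.subtype (a ^ t)) (Submodule.mkQ (a ^ t))
    Subtype.val_injective (Submodule.mkQ_surjective _)
    (LinearMap.exact_subtype_mkQ _)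
  have h₁ := hses (t + s)
  have h₂ := hses t
  have hle : a ^ (t + s) ≤ a ^ t := Ideal.pow_le_pow_right (by omega)
  let φ : scOf h₁ ⟶ scOf h₂ :=
    { τ₁ := ModuleCat.ofHom (Submodule.inclusion hle)
      τ₂ := 𝟙 _
      τ₃ := Q a (by omega)
      comm₁₂ := rfl
      comm₂₃ := rfl }
  have hz : pull (ModuleCat.ofHom (Submodule.mkQ (a ^ t))) x = 0 := by
    have : Projective (ModuleCat.of R R) :=
      (IsProjective.iff_projective _).1 inferInstance
    exact Abelian.Ext.eq_zero_of_projective _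
  obtain ⟨x₁, rfl⟩ := Abelian.Ext.contravariant_sequence_exact₃ h₂ _ x hz (add_comm 1 i)
  refine (pull_extClass h₁ h₂ φ x₁ (add_comm 1 i)).trans ?_
  have hK : ∀ y : (a ^ (t + s) : Ideal R), Submodule.inclusion hle y ∈
      (a ^ s • ⊤ : Submodule R (a ^ t : Ideal R)) := by
    rintro ⟨y, hy⟩
    have h3 : y ∈ (a ^ s • ⊤ : Submodule R (a ^ t : Ideal R)).map
        (Submodule.subtype (a ^ t)) := by
      rw [Submodule.map_smul'', Submodule.map_top, Submodule.range_subtype, smul_eq_mul,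
        ← pow_add, add_comm]
      exact hy
    obtain ⟨z, hz, rfl⟩ := h3
    exact hz
  have h6 : pull φ.τ₁ x₁ = 0 := pull_factor _ _ hK x₁ (hs x₁)
  rw [h6]
  simp

lemma van_mid {S : ShortComplex (ModuleCat.{u} R)} (hS : S.ShortExact) (a : Ideal R) (i : ℕ)
    (h1 : Van a i S.X₁) (h3 : Van a i S.X₃) : Van a i S.X₂ := by
  intro t x
  obtain ⟨s, hs, h⟩ := h3 t (push x S.g)
  rw [pull_push] at h
  obtain ⟨y, hy⟩ := Abelian.Ext.covariant_sequence_exact₂ _ hS _ h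
  obtain ⟨v, hv, h'⟩ := h1 s y
  refine ⟨v, hs.trans hv, ?_⟩
  rw [← Q_comp a hs hv, ← pull_pull, ← hy]
  erw [pull_push]
  rw [h']
  simp [push]

lemma smul_zero_of_mem {a : Ideal R} {t : ℕ} {N : ModuleCat.{u} R} {i : ℕ} {r : R}
    (hr : r ∈ a ^ t) (x : Abelian.Ext (ModuleCat.of R (R ⧸ a ^ t)) N i) : r • x = 0 := by
  have h : r • 𝟙 (ModuleCat.of R (R ⧸ a ^ t)) = 0 := by
    refine ModuleCat.hom_ext (LinearMap.ext fun y => ?_)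
    obtain ⟨y, rfl⟩ := Submodule.Quotient.mk_surjective _ y
    change r • Submodule.Quotient.mk y = (0 : R ⧸ a ^ t)
    rw [← Submodule.Quotient.mk_smul, Submodule.Quotient.mk_eq_zero, smul_eq_mul]
    exact Ideal.mul_mem_right _ _ hr
  have : r • x = (Abelian.Ext.mk₀ (r • 𝟙 (ModuleCat.of R (R ⧸ a ^ t)))).comp x (zero_add i) := by
    simp [Abelian.Ext.mk₀_smul]
  rw [this, h]
  simp

lemma van_reg (a : Ideal R) (i : ℕ) (N : Type u) [AddCommGroup N] [Module R N] (r : R)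
    (hr : r ∈ a) (hreg : IsSMulRegular N r)
    (h3 : Van a i (ModuleCat.of R (QuotSMulTop r N))) : Van a (i + 1) (ModuleCat.of R N) := by
  have hS := mkSES (LinearMap.lsmul R N r) (Submodule.mkQ (r • ⊤ : Submodule R N)) hreg
    (Submodule.mkQ_surjective _) (by
      intro x
      simp [Submodule.mem_smul_pointwise_iff_exists])
  have key : ∀ (k t : ℕ) (x : Abelian.Ext (ModuleCat.of R (R ⧸ a ^ t)) (ModuleCat.of R N) (i+1)),
      r ^ k • x = 0 → ∃ (s : ℕ) (h : t ≤ s), pull (Q a h) x = 0 := by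
    intro k
    induction k with
    | zero => 
      intro t x hx
      rw [pow_zero, one_smul] at hx
      exact ⟨t, le_rfl, by simp [hx, pull]⟩
    | succ k ih =>
      intro t x hx
      have h1 : push (r ^ k • x) (ModuleCat.ofHom (LinearMap.lsmul R N r)) = 0 := by
        rw [← hx, pow_succ', mul_smul]
        have : ModuleCat.ofHom (LinearMap.lsmul R N r) = r • 𝟙 (ModuleCat.of R N) := rfl
        rw [this]
        simp only [push, Abelian.Ext.mk₀_smul, Abelian.Ext.comp_smul, Abelian.Ext.comp_mk₀_id]
      obtain ⟨z, hz⟩ := Abelian.Ext.covariant_sequence_exact₁ _ hS _ h1 rfl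
      obtain ⟨s, hs, h⟩ := h3 t z
      have h2 : r ^ k • pull (Q a hs) x = 0 := by
        have : r ^ k • pull (Q a hs) x = pull (Q a hs) (r ^ k • x) := by simp [pull]
        rw [this, ← hz, pull_comp]
        erw [h]
        simp
      obtain ⟨v, hv, h'⟩ := ih s _ h2
      exact ⟨v, hs.trans hv, by rw [← Q_comp a hs hv, ← pull_pull, h']⟩
  intro t x
  exact key t t x (smul_zero_of_mem (Ideal.pow_mem_pow hr t) x)

lemma van_zero (a : Ideal R) (i : ℕ) (N : Type u) [AddCommGroup N] [Module R N]
    [Subsingleton N] : Van a i (ModuleCat.of R N) := by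
  intro t x
  refine ⟨t, le_rfl, ?_⟩
  have : x = 0 := by
    rw [← Abelian.Ext.comp_mk₀_id x]
    have : 𝟙 (ModuleCat.of R N) = 0 := by ext y; exact Subsingleton.elim (α := N) _ _
    rw [this]; simp
  rw [this]; simp [pull]

lemma surj_aux (a : Ideal R) (n : ℕ) (M : Type u) [AddCommGroup M] [Module R M] (r : R)
    (hK : Van a (n + 1) (ModuleCat.of R (LinearMap.ker (LinearMap.lsmul R M r))))
    (hC : Van a n (ModuleCat.of R (M ⧸ LinearMap.range (LinearMap.lsmul R M r))))
    (t : ℕ) (x : Abelian.Ext (ModuleCat.of R (R ⧸ a ^ t)) (ModuleCat.of R M) n) :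
    ∃ (s : ℕ) (h : t ≤ s) (y : Abelian.Ext (ModuleCat.of R (R ⧸ a ^ s)) (ModuleCat.of R M) n),
      r • y = pull (Q a h) x := by
  have h₁ := mkSES (LinearMap.ker (LinearMap.lsmul R M r)).subtype
    (LinearMap.lsmul R M r).rangeRestrict Subtype.val_injective
    (LinearMap.surjective_rangeRestrict _) (by
      intro x
      simp [Subtype.ext_iff])
  have h₂ := mkSES (LinearMap.range (LinearMap.lsmul R M r)).subtype
    (LinearMap.range (LinearMap.lsmul R M r)).mkQ Subtype.val_injective
    (Submodule.mkQ_surjective _) (LinearMap.exact_subtype_mkQ _)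
  obtain ⟨s, hs, h⟩ := hC t (push x (ModuleCat.ofHom (Submodule.mkQ _)))
  rw [pull_push] at h
  obtain ⟨y, hy⟩ := Abelian.Ext.covariant_sequence_exact₂ _ h₂ _ h
  obtain ⟨v, hv, h'⟩ := hK s (y.comp h₁.extClass rfl)
  rw [pull_comp] at h'
  obtain ⟨z, hz⟩ := Abelian.Ext.covariant_sequence_exact₃ _ h₁ _ rfl h'
  refine ⟨v, hs.trans hv, z, ?_⟩
  rw [← Q_comp a hs hv, ← pull_pull, ← hy]
  erw [pull_push]
  erw [← hz]
  refine Eq.trans ?_ (push_push z (ModuleCat.ofHom (LinearMap.lsmul R M r).rangeRestrict)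
    (ModuleCat.ofHom (LinearMap.range (LinearMap.lsmul R M r)).subtype)).symm
  rw [Abelian.Ext.smul_eq_comp_mk₀]
  rfl

end LCaux
namespace LCaux
open scoped Pointwise
section dims
variable {R : Type u} [CommRing R] [IsNoetherianRing R]

lemma exists_regular (a : Ideal R) (N : Type u) [AddCommGroup N] [Module R N] [Module.Finite R N]
    (h : ∀ x : N, (∀ r ∈ a, r • x = 0) → x = 0) : ∃ r ∈ a, IsSMulRegular N r := by
  by_contra! hcon
  obtain ⟨P, hP, haP⟩ : ∃ P ∈ associatedPrimes R N, a ≤ P :=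
    (a.subset_union_prime_finite (associatedPrimes.finite ..) (f := id) 0 0 fun _ h _ _ ↦ h.1).1 <| by
      simp only [id]
      rw [biUnion_associatedPrimes_eq_compl_regular]
      exact fun r hr => hcon r hr
  rw [AssociatedPrimes.mem_iff, isAssociatedPrime_iff] at hP
  obtain ⟨prime, x, rfl⟩ := hP
  have : x = 0 := h x fun r hr => by
    have := haP hr
    simpa [Submodule.mem_colon_singleton] using this
  subst this
  exact prime.ne_top (by simp)

lemma van_of_dim (a : Ideal R) (d : ℕ) :
    ∀ (N : Type u) [AddCommGroup N] [Module R N] [Module.Finite R N],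
      Module.supportDim R N < (d : ℕ) → ∀ i, d ≤ i → Van a i (ModuleCat.of R N) := by
  induction d with
  | zero =>
    intro N _ _ _ h i _
    have : Subsingleton N := by
      rw [← Module.supportDim_eq_bot_iff_subsingleton (R := R)]
      generalize Module.supportDim R N = x at h
      induction x with
      | bot => rfl
      | coe x => exact absurd h (by simp)
    exact van_zero a i N
  | succ d ih =>
    intro N _ _ _ h i hi
    obtain ⟨i, rfl⟩ : ∃ j, i = j + 1 := ⟨i - 1, by omega⟩
    obtain ⟨W, ⟨k, hk⟩, hmax⟩ := set_has_maximal_iff_noetherian.2 (inferInstance : IsNoetherian R N)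
      {W : Submodule R N | ∃ k, a ^ k • W = ⊥} ⟨⊥, 0, by simp⟩
    have hS := mkSES W.subtype W.mkQ Subtype.val_injective (Submodule.mkQ_surjective _)
      (LinearMap.exact_subtype_mkQ _)
    refine van_mid hS a (i + 1) (van_tors a k _ ?_ i) ?_
    · intro r hr x
      have : r • x.1 ∈ a ^ k • W := Submodule.smul_mem_smul hr x.2
      rw [hk] at this
      exact Subtype.ext this
    · obtain ⟨r, hr, hreg⟩ := exists_regular a (N ⧸ W) (by
        intro x hx
        obtain ⟨x, rfl⟩ := Submodule.Quotient.mk_surjective _ x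
        rw [Submodule.Quotient.mk_eq_zero]
        by_contra hxW
        refine hmax (W ⊔ R ∙ x) ⟨k + 1, ?_⟩ ?_
        · rw [pow_succ, mul_smul, eq_bot_iff, ← hk]
          refine Submodule.smul_mono le_rfl ?_
          rw [Submodule.smul_sup, sup_le_iff]
          refine ⟨Submodule.smul_le_right, ?_⟩
          rw [Submodule.smul_le]
          intro r hr y hy
          obtain ⟨c, rfl⟩ := Submodule.mem_span_singleton.1 hy
          rw [smul_comm]
          refine W.smul_mem _ ?_
          have := hx r hr
          rwa [← Submodule.Quotient.mk_smul, Submodule.Quotient.mk_eq_zero] at this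
        · refine lt_of_le_of_ne le_sup_left fun h => hxW ?_
          rw [h]
          exact Submodule.mem_sup_right (Submodule.mem_span_singleton_self x))
      refine van_reg a i (N ⧸ W) r hr hreg (ih _ ?_ i (by omega))
      have h1 := Module.supportDim_quotSMulTop_succ_le_of_notMem_minimalPrimes (R := R)
        (M := N ⧸ W) (x := r) (fun _ ↦ hreg.notMem_of_mem_minimalPrimes)
      have h2 := (h1.trans (Module.supportDim_le_of_surjective W.mkQ
        (Submodule.mkQ_surjective _))).trans_lt h
      generalize Module.supportDim R (QuotSMulTop r (N ⧸ W)) = x at h2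
      induction x with
      | bot => exact WithBot.bot_lt_coe _
      | coe x =>
        have h3 : ((x + 1 : ℕ∞) : WithBot ℕ∞) < ((d + 1 : ℕ) : ℕ∞) := h2
        have h4 : x + 1 < ((d + 1 : ℕ) : ℕ∞) := WithBot.coe_lt_coe.1 h3
        refine WithBot.coe_lt_coe.2 (?_ : x < (d : ℕ∞))
        push_cast at h4
        exact lt_of_add_lt_add_right h4

lemma mem_supp_quot (q : Ideal R) (x : PrimeSpectrum R) :
    x ∈ Module.support R (R ⧸ q) ↔ q ≤ x.asIdeal := by
  rw [Module.mem_support_iff_of_finite, Ideal.annihilator_quotient]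

variable {M : Type u} [AddCommGroup M] [Module R M] [Module.Finite R M] {n : ℕ}

/-- No point of the support lies strictly below the head of a chain of full length. -/
lemma no_below (hdim : Module.supportDim R M = (n : ℕ∞))
    (l : LTSeries (PrimeSpectrum R)) (hl : l.length = n)
    (hmem : ∀ i, l i ∈ Module.support R M) (p : PrimeSpectrum R)
    (hp : p ∈ Module.support R M) : ¬ p < l.head := by
  intro hlt
  let l' : LTSeries (Module.support R M) := LTSeries.mk l.length (fun i => ⟨l i, hmem i⟩)
    (fun i j h => l.strictMono h)
  let l'' : LTSeries (Module.support R M) := l'.cons ⟨p, hp⟩ hlt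
  have h := Order.LTSeries.length_le_krullDim l''
  have h2 : l''.length = n + 1 := (RelSeries.cons_length l' ⟨p, hp⟩ hlt).trans (congrArg (· + 1) hl)
  rw [h2] at h
  change _ ≤ Module.supportDim R M at h
  rw [hdim] at h
  have h3 : ((n + 1 : ℕ) : ℕ∞) ≤ n := WithBot.coe_le_coe.1 h
  have : n + 1 ≤ n := by exact_mod_cast h3
  omega

lemma dim_lt (hdim : Module.supportDim R M = (n : ℕ∞)) (N : Type u) [AddCommGroup N] [Module R N]
    (r : R) (hrN : ∀ x : N, r • x = 0) (hN : Module.support R N ⊆ Module.support R M)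
    (hr : ∀ q ∈ associatedPrimes R M, Module.supportDim R (R ⧸ q) = (n : ℕ∞) → r ∉ q) :
    Module.supportDim R N < (n : ℕ) := by
  by_contra! hcon
  obtain ⟨l, hl⟩ := Order.le_krullDim_iff.1 hcon
  let l' : LTSeries (PrimeSpectrum R) := LTSeries.mk l.length (fun i => (l i).1)
    (fun i j h => l.strictMono h)
  have hl' : l'.length = n := hl
  have hmem : ∀ i, l' i ∈ Module.support R M := fun i => hN (l i).2
  have hmin := no_below hdim l' hl' hmem
  have h0 : l'.head ∈ Module.support R M := hmem 0
  have hass : l'.head.asIdeal ∈ associatedPrimes R M := by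
    apply Module.associatedPrimes.minimalPrimes_annihilator_subset_associatedPrimes
    refine ⟨⟨l'.head.2, Module.mem_support_iff_of_finite.1 h0⟩, ?_⟩
    rintro q ⟨hq, hq2⟩ hle
    by_contra hn
    exact hmin ⟨q, hq⟩ (Module.mem_support_iff_of_finite.2 hq2) ⟨hle, hn⟩
  refine hr _ hass ?_ ?_
  · refine le_antisymm ?_ ?_
    · rw [← hdim]
      refine Order.krullDim_le_of_strictMono (fun x => ⟨x.1, ?_⟩) (fun _ _ h => h)
      exact Module.mem_support_mono ((mem_supp_quot _ _).1 x.2) h0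
    · refine Order.le_krullDim_iff.2 ⟨LTSeries.mk l'.length (fun i => ⟨l' i, ?_⟩)
        (fun i j h => l'.strictMono h), hl'⟩
      exact (mem_supp_quot _ _).2 (l'.head_le i)
  · have : l'.head ∈ Module.support R N := (l 0).2
    exact Module.annihilator_le_of_mem_support this (Module.mem_annihilator.2 hrN)

/-- The purely module-theoretic part of the main theorem. -/
lemma main_aux (hdim : Module.supportDim R M = (n : ℕ∞)) (p : Ideal R) [hp : p.IsPrime]
    (hann : Module.annihilator R M ≤ p)
    (hnot : ∀ r ∈ p, ¬ (Module.supportDim R (LinearMap.ker (LinearMap.lsmul R M r)) < (n : ℕ) ∧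
      Module.supportDim R (M ⧸ LinearMap.range (LinearMap.lsmul R M r)) < (n : ℕ))) :
    p ∈ associatedPrimes R M ∧ Module.supportDim R (R ⧸ p) = (n : ℕ∞) := by
  obtain ⟨q, ⟨hq, hqn⟩, hpq⟩ :
      ∃ q ∈ {q | q ∈ associatedPrimes R M ∧ Module.supportDim R (R ⧸ q) = (n : ℕ∞)}, p ≤ q :=
    (p.subset_union_prime_finite ((associatedPrimes.finite R M).subset fun _ h => h.1)
      (f := id) 0 0 fun _ h _ _ ↦ h.1.1).1 <| by
      intro r hr
      by_contra hcon
      simp only [id, Set.mem_iUnion, not_exists] at hcon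
      have hr' : ∀ q ∈ associatedPrimes R M, Module.supportDim R (R ⧸ q) = (n : ℕ∞) → r ∉ q :=
        fun q h1 h2 h3 => hcon q ⟨h1, h2⟩ h3
      refine hnot r hr ⟨dim_lt hdim _ r ?_ ?_ hr', dim_lt hdim _ r ?_ ?_ hr'⟩
      · intro x
        exact Subtype.ext x.2
      · exact Module.support_subset_of_injective _ (Submodule.subtype_injective _)
      · intro x
        obtain ⟨x, rfl⟩ := Submodule.Quotient.mk_surjective _ x
        rw [← Submodule.Quotient.mk_smul, Submodule.Quotient.mk_eq_zero]
        exact ⟨x, rfl⟩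
      · exact Module.support_subset_of_surjective _ (Submodule.mkQ_surjective _)
  suffices h : p = q by subst h; exact ⟨hq, hqn⟩
  have hqp : q.IsPrime := hq.1
  obtain ⟨l, hl⟩ := Order.le_krullDim_iff.1 (le_of_eq hqn.symm)
  let l' : LTSeries (PrimeSpectrum R) := LTSeries.mk l.length (fun i => (l i).1)
    (fun i j h => l.strictMono h)
  have hps : (⟨p, hp⟩ : PrimeSpectrum R) ∈ Module.support R M :=
    Module.mem_support_iff_of_finite.2 hann
  have hle : ∀ i, q ≤ (l' i).asIdeal := fun i => (mem_supp_quot _ _).1 (l i).2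
  by_contra hne
  refine no_below hdim l' hl (fun i => Module.mem_support_mono (hpq.trans (hle i)) hps) ⟨p, hp⟩
    hps ?_
  exact (lt_of_le_of_ne hpq hne).trans_le (hle 0)

end dims
end LCaux

namespace LCaux
section ext
variable {R : Type u} [CommRing R]

/-- The functor `Hom(-, Y)`. -/
abbrev FY (Y : ModuleCat.{u} R) : ModuleCat.{u} R ⥤ (ModuleCat.{u} R)ᵒᵖ :=
  ((linearYoneda R (ModuleCat.{u} R)).obj Y).rightOp

/-- The Hom complex. -/
abbrev AC {X : ModuleCat.{u} R} (P : ProjectiveResolution X) (Y : ModuleCat.{u} R) :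
    ChainComplex (ModuleCat.{u} R)ᵒᵖ ℕ :=
  ((FY Y).mapHomologicalComplex (ComplexShape.down ℕ)).obj P.complex

/-- The old-style Ext group. -/
abbrev GE (X Y : ModuleCat.{u} R) (n : ℕ) : ModuleCat.{u} R :=
  ((Ext R (ModuleCat.{u} R) n).obj (Opposite.op X)).obj Y

/-- The comparison isomorphism. -/
def isoH {X : ModuleCat.{u} R} (P : ProjectiveResolution X) (Y : ModuleCat.{u} R) (n : ℕ) :
    ((FY Y).leftDerived n).obj X ≅ (AC P Y).homology n :=
  P.isoLeftDerivedObj (FY Y) n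

def qq {X : ModuleCat.{u} R} (P : ProjectiveResolution X) (Y : ModuleCat.{u} R) (n : ℕ) :
    ((AC P Y).opcycles n).unop ⟶ GE X Y n :=
  ((isoH P Y n).hom ≫ (AC P Y).homologyι n).unop

def jj {X : ModuleCat.{u} R} (P : ProjectiveResolution X) (Y : ModuleCat.{u} R) (n : ℕ) :
    ((AC P Y).opcycles n).unop ⟶ ModuleCat.of R (P.complex.X n ⟶ Y) :=
  ((AC P Y).pOpcycles n).unop

variable {X Y : ModuleCat.{u} R} (P : ProjectiveResolution X) {n : ℕ}

/-- `f` is a cocycle representing `g`. -/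
def Rep (f : P.complex.X n ⟶ Y) (g : GE X Y n) : Prop :=
  ∃ z, (jj P Y n).hom z = f ∧ (qq P Y n).hom z = g

lemma jj_inj : Function.Injective (jj P Y n).hom := by
  have : Mono (jj P Y n) := unop_mono_of_epi ((AC P Y).pOpcycles n)
  exact (ModuleCat.mono_iff_injective _).1 this

lemma qq_surj : Function.Surjective (qq P Y n).hom := by
  have : Epi (qq P Y n) := unop_epi_of_mono ((isoH P Y n).hom ≫ (AC P Y).homologyι n)
  exact (ModuleCat.epi_iff_surjective _).1 this

lemma jj_d (m : ℕ) (z) : P.complex.d m n ≫ ((jj P Y n).hom z : P.complex.X n ⟶ Y) = 0 := by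
  have h := congrArg Quiver.Hom.unop ((AC P Y).d_pOpcycles m n)
  exact LinearMap.congr_fun (congrArg ModuleCat.Hom.hom h) z

lemma exists_rep (g : GE X Y n) : ∃ f : P.complex.X n ⟶ Y, P.complex.d (n + 1) n ≫ f = 0 ∧ Rep P f g := by
  obtain ⟨z, hz⟩ := qq_surj P g
  exact ⟨_, jj_d P (n + 1) z, z, rfl, hz⟩

lemma exists_of_cocycle (f : P.complex.X n ⟶ Y) (hf : P.complex.d (n + 1) n ≫ f = 0) :
    ∃ g, Rep P f g := by
  let k : ModuleCat.of R R ⟶ ModuleCat.of R (P.complex.X n ⟶ Y) :=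
    ModuleCat.ofHom (LinearMap.toSpanSingleton R _ f)
  have hk : k ≫ ((AC P Y).d (n + 1) n).unop = 0 := by
    ext
    change P.complex.d (n + 1) n ≫ ((1 : R) • f) = 0
    rw [one_smul, hf]
  let D := (AC P Y).descOpcycles (i := n) (A := Opposite.op (ModuleCat.of R R)) k.op (n + 1) (by simp)
    (congrArg Quiver.Hom.op hk)
  refine ⟨_, D.unop.hom (1 : R), ?_, rfl⟩
  have h : (AC P Y).pOpcycles n ≫ D = k.op := HomologicalComplex.p_descOpcycles ..
  have h2 := LinearMap.congr_fun (congrArg ModuleCat.Hom.hom (congrArg Quiver.Hom.unop h)) (1 : R)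
  refine Eq.trans h2 ?_
  change (1 : R) • f = f
  rw [one_smul]

variable {P}
lemma Rep.sub {f f' : P.complex.X n ⟶ Y} {g g'} (h : Rep P f g) (h' : Rep P f' g') :
    Rep P (f - f') (g - g') := by
  obtain ⟨z, rfl, rfl⟩ := h
  obtain ⟨z', rfl, rfl⟩ := h'
  exact ⟨z - z', map_sub _ _ _, map_sub _ _ _⟩

lemma Rep.smul {f : P.complex.X n ⟶ Y} {g} (r : R) (h : Rep P f g) :
    Rep P (r • f) (r • g) := by
  obtain ⟨z, rfl, rfl⟩ := h
  exact ⟨r • z, map_smul _ _ _, map_smul _ _ _⟩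

lemma Rep.zero {g : GE X Y n} (h : Rep P (0 : P.complex.X n ⟶ Y) g) : g = 0 := by
  obtain ⟨z, hz, rfl⟩ := h
  have : z = 0 := jj_inj P (hz.trans (map_zero (jj P Y n).hom).symm)
  rw [this, map_zero]

lemma Rep.cob {g : GE X Y n} (p : ℕ) (f : P.complex.X p ⟶ Y) (h : Rep P (P.complex.d n p ≫ f) g) :
    g = 0 := by
  obtain ⟨z, hz, rfl⟩ := h
  let w := ((AC P Y).fromOpcycles n p).unop.hom f
  have hw : (jj P Y n).hom w = P.complex.d n p ≫ f := by
    have h := congrArg Quiver.Hom.unop ((AC P Y).p_fromOpcycles n p)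
    exact LinearMap.congr_fun (congrArg ModuleCat.Hom.hom h) f
  have : z = w := jj_inj P (hz.trans hw.symm)
  rw [this]
  have h : ((isoH P Y n).hom ≫ (AC P Y).homologyι n) ≫ (AC P Y).fromOpcycles n p = 0 := by
    rw [Category.assoc, HomologicalComplex.homologyι_comp_fromOpcycles, Limits.comp_zero]
  exact LinearMap.congr_fun (congrArg ModuleCat.Hom.hom (congrArg Quiver.Hom.unop h)) f

lemma Rep.nat {f : P.complex.X n ⟶ Y} {g} (h : Rep P f g) {X' : ModuleCat.{u} R}
    {P' : ProjectiveResolution X'} {φ : X' ⟶ X} (Φ : ProjectiveResolution.Hom P' P φ) :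
    Rep P' (Φ.hom.f n ≫ f) ((((Ext R (ModuleCat.{u} R) n).map φ.op).app Y).hom g) := by
  obtain ⟨z, rfl, rfl⟩ := h
  let Ψ : AC P' Y ⟶ AC P Y := ((FY Y).mapHomologicalComplex _).map Φ.hom
  refine ⟨(HomologicalComplex.opcyclesMap Ψ n).unop.hom z, ?_, ?_⟩
  · have h := congrArg Quiver.Hom.unop (HomologicalComplex.p_opcyclesMap Ψ n)
    exact LinearMap.congr_fun (congrArg ModuleCat.Hom.hom h) z
  · have h1 : ((FY Y).leftDerived n).map φ ≫ (isoH P Y n).hom =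
        (isoH P' Y n).hom ≫ HomologicalComplex.homologyMap Ψ n := ProjectiveResolution.isoLeftDerivedObj_hom_naturality φ P' P Φ.hom Φ.hom_f_zero_comp_π_f_zero (FY Y) n
    have h2 : ((FY Y).leftDerived n).map φ ≫ (isoH P Y n).hom ≫ (AC P Y).homologyι n =
      ((isoH P' Y n).hom ≫ (AC P' Y).homologyι n) ≫ HomologicalComplex.opcyclesMap Ψ n := by
      rw [← Category.assoc, h1, Category.assoc, Category.assoc, ← HomologicalComplex.homologyι_naturality]
    exact (LinearMap.congr_fun (congrArg ModuleCat.Hom.hom (congrArg Quiver.Hom.unop h2)) z).symm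

/-- A lift. -/
def liftHom {X' : ModuleCat.{u} R} (P' : ProjectiveResolution X') (P : ProjectiveResolution X)
    (φ : X' ⟶ X) : ProjectiveResolution.Hom P' P φ where
  hom := ProjectiveResolution.lift φ P' P
  hom_f_zero_comp_π_f_zero := by
    have := HomologicalComplex.congr_hom (ProjectiveResolution.lift_commutes φ P' P) 0
    rwa [HomologicalComplex.comp_f, HomologicalComplex.comp_f,
      ChainComplex.single₀_map_f_zero] at this

open CochainComplex HomComplex in
lemma cob_of_extMk {f : P.complex.X n ⟶ Y} (hf : P.complex.d (n + 1) n ≫ f = 0)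
    (h0 : P.extMk f (n + 1) rfl hf = 0) {g} (h : Rep P f g) : g = 0 := by
  cases n with
  | succ p =>
    obtain ⟨k, rfl⟩ := (P.extMk_eq_zero_iff f _ rfl hf p rfl).1 h0
    exact h.cob p k
  | zero =>
    have hf0 : f = 0 := by
      rw [← P.extEquivCohomologyClass.apply_eq_iff_eq,
        ProjectiveResolution.extEquivCohomologyClass_extMk, ProjectiveResolution.extEquivCohomologyClass_zero,
        CohomologyClass.mk_eq_zero_iff,
        Cocycle.toSingleMk_mem_coboundaries_iff _ _ _ _ _ 1 (by lia)] at h0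
      obtain ⟨k, hk⟩ := h0
      have : k = 0 := (CochainComplex.isZero_of_isStrictlyLE P.cochainComplex 0 1 (by lia)).eq_of_src _ _
      rw [this, Limits.comp_zero] at hk
      rw [← cancel_epi (P.cochainComplexXIso (-(0 : ℕ)) 0 rfl).hom, ← hk, Limits.comp_zero]
    subst hf0
    exact h.zero

end ext
end LCaux

namespace LCaux
section colim
variable {R : Type u} [CommRing R]
open Opposite Limits localCohomology

/-- The canonical map to the colimit. -/
def iota (a : Ideal R) (n : ℕ) (Y : ModuleCat.{u} R) (t : ℕ) :
    GE (ModuleCat.of R (R ⧸ a ^ t)) Y n ⟶ (localCohomology a n).obj Y :=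
  (colimit.ι (diagram (idealPowersDiagram a) n) (op (op t))).app Y

lemma iota_w (a : Ideal R) (n : ℕ) (Y : ModuleCat.{u} R) {t s : ℕ} (h : t ≤ s)
    (g : GE (ModuleCat.of R (R ⧸ a ^ t)) Y n) :
    (iota a n Y s).hom ((((Ext R (ModuleCat.{u} R) n).map (Q a h).op).app Y).hom g) =
      (iota a n Y t).hom g := by
  have w : (op (op t) : (ℕᵒᵖ)ᵒᵖ) ⟶ op (op s) := (homOfLE h).op.op
  have h1 := congrArg (fun z => z.app Y) (colimit.w (diagram (idealPowersDiagram a) n) w)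
  exact LinearMap.congr_fun (congrArg ModuleCat.Hom.hom h1) g

lemma iota_surj (a : Ideal R) (n : ℕ) (Y : ModuleCat.{u} R) (τ : (localCohomology a n).obj Y) :
    ∃ t g, (iota a n Y t).hom g = τ := by
  have : PreservesFilteredColimitsOfSize.{0, 0} (forget (ModuleCat.{u} R)) :=
    preservesFilteredColimitsOfSize_shrink.{0, u, 0, u} _
  obtain ⟨t, g, h⟩ := Concrete.isColimit_exists_rep _
    (isColimitOfPreserves ((evaluation _ _).obj Y)
      (colimit.isColimit (diagram (idealPowersDiagram a) n))) τ
  exact ⟨t.unop.unop, g, h⟩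

/-- A chosen resolution. -/
def PR (X : ModuleCat.{u} R) : ProjectiveResolution X := projectiveResolution X

lemma T_ann (a : Ideal R) (n : ℕ) (M : Type u) [AddCommGroup M] [Module R M] :
    Module.annihilator R M ≤ Module.annihilator R ((localCohomology a n).obj (ModuleCat.of R M)) := by
  intro r hr
  rw [Module.mem_annihilator] at hr ⊢
  intro τ
  obtain ⟨t, g, rfl⟩ := iota_surj a n _ τ
  obtain ⟨f, -, hf⟩ := exists_rep (PR _) g
  have h0 : r • f = 0 := by
    ext x
    exact hr (f.hom x)
  have h1 := hf.smul r
  rw [h0] at h1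
  rw [← map_smul, h1.zero, map_zero]

lemma extMk_smul {X Y : ModuleCat.{u} R} (P : ProjectiveResolution X) (n : ℕ)
    (f : P.complex.X n ⟶ Y) (hf : P.complex.d (n + 1) n ≫ f = 0) (r : R) :
    r • P.extMk f (n + 1) rfl hf = P.extMk (r • f) (n + 1) rfl (by simp [hf]) := by
  rw [Abelian.Ext.smul_eq_comp_mk₀, ProjectiveResolution.extMk_comp_mk₀]
  congr 1

lemma T_surj (a : Ideal R) (n : ℕ) (Y : ModuleCat.{u} R) (r : R)
    (H : ∀ t (x : Abelian.Ext (ModuleCat.of R (R ⧸ a ^ t)) Y n),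
      ∃ s, ∃ (h : t ≤ s) (y : Abelian.Ext (ModuleCat.of R (R ⧸ a ^ s)) Y n),
        r • y = pull (Q a h) x) (τ : (localCohomology a n).obj Y) : ∃ τ', r • τ' = τ := by
  obtain ⟨t, g, rfl⟩ := iota_surj a n _ τ
  obtain ⟨f, hf, hfg⟩ := exists_rep (PR _) g
  obtain ⟨s, h, y, hy⟩ := H t ((PR _).extMk f (n + 1) rfl hf)
  obtain ⟨f', hf', rfl⟩ := (PR _).extMk_surjective y (n + 1) rfl
  obtain ⟨g', hfg'⟩ := exists_of_cocycle _ f' hf'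
  let Φ := liftHom (PR _) (PR _) (Q a h)
  have h1 := (hfg'.smul r).sub (hfg.nat Φ)
  rw [extMk_smul, pull, ProjectiveResolution.mk₀_comp_extMk f _ rfl hf Φ, ← sub_eq_zero,
    ProjectiveResolution.sub_extMk] at hy
  have h2 := cob_of_extMk _ hy h1
  refine ⟨(iota a n Y s).hom g', ?_⟩
  rw [← map_smul, sub_eq_zero.1 h2, iota_w]

end colim
end LCaux

theorem stmt1 (R : Type u) [CommRing R] [IsNoetherianRing R] [IsLocalRing R]
    (a : Ideal R) (ha : a ≠ ⊤) (M : Type u) [AddCommGroup M] [Module R M]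
    [Module.Finite R M] (n : ℕ) (hdim : mdim R M = (n : ℕ∞)) :
    Att R (LC a n M) ⊆
      { p : Ideal R | p ∈ associatedPrimes R M ∧ mdim R (R ⧸ p) = (n : ℕ∞) } := by
  rintro p ⟨hp, U, hU⟩
  have hT := LCaux.T_ann a n M
  refine LCaux.main_aux hdim p ?_ ?_
  · refine hT.trans ?_
    rw [hU]
    exact LinearMap.annihilator_le_of_surjective U.mkQ U.mkQ_surjective
  · rintro r hr ⟨h1, h2⟩
    have hs := LCaux.T_surj a n (ModuleCat.of R M) r fun t x =>
      LCaux.surj_aux a n M r (LCaux.van_of_dim a n _ h1 _ (Nat.le_succ n))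
        (LCaux.van_of_dim a n _ h2 _ le_rfl) t x
    apply hp.ne_top
    rw [hU, Module.annihilator_eq_top_iff]
    refine ⟨fun x y => ?_⟩
    have key : ∀ x : (LC a n M) ⧸ U, x = 0 := by
      intro x
      obtain ⟨x, rfl⟩ := U.mkQ_surjective x
      obtain ⟨y, rfl⟩ := hs x
      rw [map_smul]
      rw [hU, Module.mem_annihilator] at hr
      exact hr _
    rw [key x, key y]

end
end
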